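/- arXiv:2204.06284 — 2 statements merged into one kernel-verified Lean document; each statement's English description precedes it below -/
import Mathlib

section
/- Let G be a 3-connected graph in 𝒢₂ that contains a 5-cycle, and suppose that every 3-cutset of G is stable. Then G contains two distinct 5-cycles that share at least one edge. -/
open SimpleGraph

/-- A *hole* of length `n` in `G`: an induced cycle of length `n ≥ 4`. -/
def SimpleGraph.HasHole {V : Type*} (G : SimpleGraph V) (n : ℕ) : Prop :=
  4 ≤ n ∧ ∃ (v : V) (w : G.Walk v v), w.IsCycle ∧ w.toSubgraph.IsInduced ∧ w.length = n

/-- `G ∈ 𝒢_ℓ`: `G` has girth `2ℓ+1` and no odd hole of length at least `2ℓ+3`. -/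
def SimpleGraph.MemGFamily {V : Type*} (G : SimpleGraph V) (l : ℕ) : Prop :=
  G.egirth = (2 * l + 1 : ℕ) ∧ ∀ n : ℕ, Odd n → 2 * l + 3 ≤ n → ¬ G.HasHole n

/-- `X` is a cutset of `G`: deleting the vertices of `X` disconnects `G`. -/
def SimpleGraph.IsCutset {V : Type*} (G : SimpleGraph V) (X : Set V) : Prop :=
  ¬ (G.induce (Xᶜ : Set V)).Connected

/-- `G` is 3-connected: more than 3 vertices, and deleting any at most 2 vertices
leaves a connected graph. -/
def SimpleGraph.ThreeConnected {V : Type*} [Fintype V] (G : SimpleGraph V) : Prop :=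
  3 < Fintype.card V ∧ ∀ X : Set V, X.ncard ≤ 2 → (G.induce (Xᶜ : Set V)).Connected

namespace Pentagraph

variable {V : Type*}

/-- `f 0, …, f n` is an induced path. -/
def IP (G : SimpleGraph V) (f : ℕ → V) (n : ℕ) : Prop :=
  (∀ a ≤ n, ∀ b ≤ n, f a = f b → a = b) ∧
  (∀ a ≤ n, ∀ b ≤ n, G.Adj (f a) (f b) ↔ (a + 1 = b ∨ b + 1 = a))

/-- a walk from a sequence of vertices -/
lemma walk_of_seq (G : SimpleGraph V) (n : ℕ) : ∀ (f : ℕ → V),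
    (∀ t < n, G.Adj (f t) (f (t + 1))) →
    ∃ w : G.Walk (f 0) (f n), w.length = n ∧ (∀ x, x ∈ w.support ↔ ∃ t ≤ n, x = f t) ∧
      (∀ e, e ∈ w.edges ↔ ∃ t < n, e = s(f t, f (t + 1))) ∧
      ((∀ a ≤ n, ∀ b ≤ n, f a = f b → a = b) → w.IsPath) := by
  induction n with
  | zero =>
    intro f _
    refine ⟨Walk.nil, rfl, ?_, ?_, ?_⟩
    · intro x; simp
    · intro e; simp
    · intro _; simp
  | succ n ih =>
    intro f hf
    obtain ⟨w, hl, hs, he, hp⟩ := ih (fun t => f (t + 1)) (fun t ht => hf (t + 1) (by omega))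
    refine ⟨Walk.cons (hf 0 (by omega)) w, by simp [hl], ?_, ?_, ?_⟩
    · intro x
      rw [Walk.support_cons, List.mem_cons, hs]
      constructor
      · rintro (h | ⟨t, ht, h⟩)
        · exact ⟨0, by omega, h⟩
        · exact ⟨t + 1, by omega, h⟩
      · rintro ⟨t, ht, h⟩
        rcases t with _ | t
        · exact Or.inl h
        · exact Or.inr ⟨t, by omega, h⟩
    · intro e
      rw [Walk.edges_cons, List.mem_cons, he]
      constructor
      · rintro (h | ⟨t, ht, h⟩)
        · exact ⟨0, by omega, h⟩
        · exact ⟨t + 1, by omega, h⟩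
      · rintro ⟨t, ht, h⟩
        rcases t with _ | t
        · exact Or.inl h
        · exact Or.inr ⟨t, by omega, h⟩
    · intro hinj
      rw [Walk.cons_isPath_iff]
      refine ⟨hp ?_, ?_⟩
      · intro a ha b hb h
        have := hinj (a + 1) (by omega) (b + 1) (by omega) h
        omega
      · rw [hs]
        rintro ⟨t, ht, h⟩
        have := hinj 0 (by omega) (t + 1) (by omega) h
        omega

/-- a cycle from a sequence of vertices -/
lemma cycle_of_seq (G : SimpleGraph V) (n : ℕ) (hn : 2 ≤ n) (f : ℕ → V)
    (hf : ∀ t < n, G.Adj (f t) (f (t + 1))) (hc : G.Adj (f n) (f 0))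
    (hinj : ∀ a ≤ n, ∀ b ≤ n, f a = f b → a = b) :
    ∃ w : G.Walk (f n) (f n), w.IsCycle ∧ w.length = n + 1 ∧
      (∀ x, x ∈ w.support ↔ ∃ t ≤ n, x = f t) ∧
      (∀ e, e ∈ w.edges ↔ e = s(f n, f 0) ∨ ∃ t < n, e = s(f t, f (t + 1))) := by
  obtain ⟨w, hl, hs, he, hp⟩ := walk_of_seq G n f hf
  refine ⟨Walk.cons hc w, ?_, by simp [hl], ?_, ?_⟩
  · rw [Walk.cons_isCycle_iff]
    refine ⟨hp hinj, ?_⟩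
    rw [he]
    rintro ⟨t, ht, h⟩
    rw [Sym2.eq_iff] at h
    rcases h with ⟨h1, h2⟩ | ⟨h1, h2⟩
    · have := hinj n le_rfl t (by omega) h1
      omega
    · have := hinj n le_rfl (t + 1) (by omega) h1
      have := hinj 0 (by omega) t (by omega) h2
      omega
  · intro x
    rw [Walk.support_cons, List.mem_cons, hs]
    constructor
    · rintro (h | h)
      · exact ⟨n, le_rfl, h⟩
      · exact h
    · exact Or.inr
  · intro e
    rw [Walk.edges_cons, List.mem_cons, he]

/-- closing two induced paths into a hole -/
lemma close_hole (G : SimpleGraph V) (hodd : ∀ n : ℕ, Odd n → 7 ≤ n → ¬ G.HasHole n)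
    {f r : ℕ → V} {n m : ℕ} (hf : IP G f n) (hr : IP G r m)
    (hdisj : ∀ a ≤ n, ∀ b ≤ m, f a ≠ r b)
    (hadj : ∀ a ≤ n, ∀ b ≤ m, G.Adj (f a) (r b) ↔ ((a = n ∧ b = 0) ∨ (a = 0 ∧ b = m)))
    (h7 : 7 ≤ n + m + 2) : ¬ Odd (n + m + 2) := by
  intro ho
  apply hodd _ ho h7
  refine ⟨by omega, ?_⟩
  set g : ℕ → V := fun t => if t ≤ n then f t else r (t - n - 1) with hg
  have g1 : ∀ t ≤ n, g t = f t := fun t ht => by simp [hg, ht]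
  have g2 : ∀ t, n < t → g t = r (t - n - 1) := fun t ht => by
    simp [hg, not_le.mpr ht]
  have ginj : ∀ a ≤ n + m + 1, ∀ b ≤ n + m + 1, g a = g b → a = b := by
    intro a ha b hb h
    rcases le_or_gt a n with h1 | h1 <;> rcases le_or_gt b n with h2 | h2
    · rw [g1 a h1, g1 b h2] at h
      exact hf.1 a h1 b h2 h
    · rw [g1 a h1, g2 b h2] at h
      exact absurd h (hdisj _ h1 _ (by omega))
    · rw [g2 a h1, g1 b h2] at h
      exact absurd h.symm (hdisj _ h2 _ (by omega))
    · rw [g2 a h1, g2 b h2] at h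
      have := hr.1 _ (by omega) _ (by omega) h
      omega
  have gadj : ∀ a ≤ n + m + 1, ∀ b ≤ n + m + 1, G.Adj (g a) (g b) ↔
      (a + 1 = b ∨ b + 1 = a ∨ (a = 0 ∧ b = n + m + 1) ∨ (b = 0 ∧ a = n + m + 1)) := by
    intro a ha b hb
    rcases le_or_gt a n with h1 | h1 <;> rcases le_or_gt b n with h2 | h2
    · rw [g1 a h1, g1 b h2, hf.2 a h1 b h2]; omega
    · rw [g1 a h1, g2 b h2, hadj _ h1 _ (by omega)]; omega
    · rw [g2 a h1, g1 b h2, G.adj_comm, hadj _ h2 _ (by omega)]; omega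
    · rw [g2 a h1, g2 b h2, hr.2 _ (by omega) _ (by omega)]; omega
  obtain ⟨w, hw, hl, hs, he⟩ := cycle_of_seq G (n + m + 1) (by omega) g
    (fun t ht => (gadj t (by omega) (t + 1) (by omega)).2 (by omega))
    ((gadj _ le_rfl 0 (by omega)).2 (by omega)) ginj
  refine ⟨_, w, hw, ?_, by omega⟩
  intro x hx y hy hxy
  rw [Walk.mem_verts_toSubgraph, hs] at hx hy
  obtain ⟨a, ha, rfl⟩ := hx
  obtain ⟨b, hb, rfl⟩ := hy
  rw [Walk.adj_toSubgraph_iff_mem_edges, he]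
  rw [gadj a ha b hb] at hxy
  rcases hxy with h | h | ⟨h, h'⟩ | ⟨h, h'⟩
  · exact Or.inr ⟨a, by omega, by rw [h]⟩
  · exact Or.inr ⟨b, by omega, by rw [h]; exact Sym2.eq_swap⟩
  · left; rw [h, h']; exact Sym2.eq_swap
  · left; rw [h, h']

/-- reachability inside a set -/
def Rch (G : SimpleGraph V) (S : Set V) : V → V → Prop :=
  Relation.ReflTransGen (fun a b => G.Adj a b ∧ a ∈ S ∧ b ∈ S)

lemma Rch.symm {G : SimpleGraph V} {S : Set V} {a b : V} (h : Rch G S a b) : Rch G S b a := by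
  induction h with
  | refl => exact Relation.ReflTransGen.refl
  | tail _ h ih => exact Relation.ReflTransGen.head ⟨h.1.symm, h.2.2, h.2.1⟩ ih

lemma Rch.mono {G : SimpleGraph V} {S T : Set V} (hST : S ⊆ T) {a b : V} (h : Rch G S a b) :
    Rch G T a b := by
  induction h with
  | refl => exact Relation.ReflTransGen.refl
  | tail _ h ih => exact Relation.ReflTransGen.tail ih ⟨h.1, hST h.2.1, hST h.2.2⟩

lemma Rch.seq {G : SimpleGraph V} {S : Set V} {a b : V} (h : Rch G S a b) (ha : a ∈ S) :
    ∃ (n : ℕ) (f : ℕ → V), f 0 = a ∧ f n = b ∧ (∀ t < n, G.Adj (f t) (f (t + 1))) ∧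
      ∀ t ≤ n, f t ∈ S := by
  induction h with
  | refl => exact ⟨0, fun _ => a, rfl, rfl, by simp, by simpa using ha⟩
  | @tail b c _ hbc ih =>
    obtain ⟨n, f, h0, hn, hadj, hS⟩ := ih
    refine ⟨n + 1, fun t => if t ≤ n then f t else c, by simp [h0], by simp, ?_, ?_⟩
    · intro t ht
      rcases Nat.lt_or_ge t n with h | h
      · simpa [h.le, Nat.succ_le_of_lt h] using hadj t h
      · have : t = n := by omega
        subst this
        simpa [hn] using hbc.1
    · intro t ht
      by_cases h : t ≤ n
      · simpa [h] using hS t h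
      · simpa [h] using hbc.2.2

lemma rch_of_connected {G : SimpleGraph V} {S : Set V} (h : (G.induce S).Connected) {a b : V}
    (ha : a ∈ S) (hb : b ∈ S) : Rch G S a b := by
  have h1 := h.preconnected ⟨a, ha⟩ ⟨b, hb⟩
  rw [SimpleGraph.reachable_iff_reflTransGen] at h1
  have key : ∀ x y : S, Relation.ReflTransGen (G.induce S).Adj x y → Rch G S x y := by
    intro x y hxy
    induction hxy with
    | refl => exact Relation.ReflTransGen.refl
    | @tail p q _ h ih => exact Relation.ReflTransGen.tail ih ⟨h, p.2, q.2⟩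
  exact key _ _ h1

/-- shortest paths between sets are induced -/
lemma minpath (G : SimpleGraph V) {S A B : Set V} {a b : V} (ha : a ∈ A) (hb : b ∈ B)
    (haS : a ∈ S) (h : Rch G S a b) :
    ∃ (n : ℕ) (f : ℕ → V), IP G f n ∧ f 0 ∈ A ∧ f n ∈ B ∧ (∀ t ≤ n, f t ∈ S) ∧
      (∀ t, 0 < t → t ≤ n → f t ∉ A) ∧ (∀ t < n, f t ∉ B) := by
  classical
  let P : ℕ → Prop := fun n => ∃ f : ℕ → V, f 0 ∈ A ∧ f n ∈ B ∧
    (∀ t < n, G.Adj (f t) (f (t + 1))) ∧ ∀ t ≤ n, f t ∈ S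
  have hP : ∃ n, P n := by
    obtain ⟨n, f, h0, hn, h1, h2⟩ := h.seq haS
    exact ⟨n, f, by rwa [h0], by rwa [hn], h1, h2⟩
  set n := Nat.find hP with hn
  obtain ⟨f, h0, h1, h2, h3⟩ := Nat.find_spec hP
  rw [← hn] at h1 h2 h3
  have hmin : ∀ k < n, ¬ P k := fun k hk => Nat.find_min hP hk
  -- shortcut
  have cut : ∀ a b, a ≤ n → b ≤ n → a + 1 < b → ¬ G.Adj (f a) (f b) := by
    intro a b ha hb hab hadj
    refine hmin (n - (b - a - 1)) (by omega)
      ⟨fun t => if t ≤ a then f t else f (t + (b - a - 1)), by simp [h0], ?_, ?_, ?_⟩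
    · have : ¬ (n - (b - a - 1) ≤ a) := by omega
      simp only [this, if_false]
      rwa [show n - (b - a - 1) + (b - a - 1) = n by omega]
    · intro t ht
      rcases Nat.lt_trichotomy t a with h | h | h
      · simpa [h.le, Nat.succ_le_of_lt h] using h2 t (by omega)
      · subst h
        simp only [le_refl, if_true, show ¬ (t + 1 ≤ t) by omega, if_false]
        rwa [show t + 1 + (b - t - 1) = b by omega]
      · simp only [show ¬ (t ≤ a) by omega, show ¬ (t + 1 ≤ a) by omega, if_false]
        have := h2 (t + (b - a - 1)) (by omega)
        rwa [show t + 1 + (b - a - 1) = t + (b - a - 1) + 1 by omega]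
    · intro t ht
      by_cases h : t ≤ a
      · simpa [h] using h3 t (by omega)
      · simpa [h] using h3 _ (by omega)
  have hB : ∀ t < n, f t ∉ B := by
    intro t ht hB
    exact hmin t ht ⟨f, h0, hB, fun s hs => h2 s (by omega), fun s hs => h3 s (by omega)⟩
  have inj : ∀ a b, a < b → b ≤ n → f a ≠ f b := by
    intro a b hab hb heq
    rcases Nat.lt_or_ge b n with h | h
    · have := h2 b h
      rw [← heq] at this
      exact cut a (b + 1) (by omega) (by omega) (by omega) this
    · have : b = n := by omega
      subst this
      exact hB a hab (by rwa [heq])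
  refine ⟨n, f, ⟨?_, ?_⟩, h0, h1, h3, ?_, hB⟩
  · intro a ha b hb h
    rcases Nat.lt_trichotomy a b with h' | h' | h'
    · exact absurd h (inj a b h' hb)
    · exact h'
    · exact absurd h.symm (inj b a h' ha)
  · intro a ha b hb
    constructor
    · intro h
      by_contra hc
      rcases Nat.lt_trichotomy a b with h' | h' | h'
      · exact cut a b ha hb (by omega) h
      · subst h'; exact G.loopless.irrefl _ h
      · exact cut b a hb ha (by omega) h.symm
    · rintro (h | h)
      · subst h; exact h2 a (by omega)
      · subst h; exact (h2 b (by omega)).symm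
  · intro t ht htn hA
    refine hmin (n - t) (by omega) ⟨fun s => f (s + t), by simpa using hA, ?_, ?_, ?_⟩
    · show f (n - t + t) ∈ B
      rwa [show n - t + t = n by omega]
    · intro s hs
      have := h2 (s + t) (by omega)
      show G.Adj (f (s + t)) (f (s + 1 + t))
      rwa [show s + 1 + t = s + t + 1 by omega]
    · intro s hs
      exact h3 _ (by omega)

lemma IP.sub {G : SimpleGraph V} {f : ℕ → V} {n : ℕ} (h : IP G f n) (s k : ℕ) (hk : s + k ≤ n) :
    IP G (fun t => f (s + t)) k := by
  refine ⟨fun a ha b hb hab => ?_, fun a ha b hb => ?_⟩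
  · have := h.1 (s + a) (by omega) (s + b) (by omega) hab
    omega
  · rw [h.2 (s + a) (by omega) (s + b) (by omega)]; omega

/-- a pentagon -/
def Pent (G : SimpleGraph V) (v : ZMod 5 → V) : Prop :=
  Function.Injective v ∧ ∀ i, G.Adj (v i) (v (i + 1))

lemma Pent.rot {G : SimpleGraph V} {v : ZMod 5 → V} (h : Pent G v) (k : ZMod 5) :
    Pent G (fun i => v (i + k)) := by
  refine ⟨fun a b hab => by simpa using h.1 hab, fun i => ?_⟩
  have := h.2 (i + k)
  rwa [show i + k + 1 = i + 1 + k by ring] at this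

lemma Pent.refl {G : SimpleGraph V} {v : ZMod 5 → V} (h : Pent G v) (k : ZMod 5) :
    Pent G (fun i => v (k - i)) := by
  refine ⟨fun a b hab => by simpa using h.1 hab, fun i => ?_⟩
  have := h.2 (k - (i + 1))
  rw [show k - (i + 1) + 1 = k - i by ring] at this
  exact this.symm

lemma z5 : ∀ i j : ZMod 5, j = i ∨ j = i + 1 ∨ i = j + 1 ∨ j = i + 2 ∨ i = j + 2 := by decide

/-- pentagon from five vertices -/
lemma pent_mk {G : SimpleGraph V} {a b c d e : V} (hab : G.Adj a b) (hbc : G.Adj b c)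
    (hcd : G.Adj c d) (hde : G.Adj d e) (hea : G.Adj e a) (h1 : a ≠ c) (h2 : a ≠ d) (h3 : b ≠ d)
    (h4 : b ≠ e) (h5 : c ≠ e) : ∃ w : ZMod 5 → V, Pent G w ∧ w 0 = a ∧ w 1 = b ∧ w 2 = c ∧
      w 3 = d ∧ w 4 = e := by
  have e1 := hab.ne
  have e2 := hbc.ne
  have e3 := hcd.ne
  have e4 := hde.ne
  have e5 := hea.ne
  let w : Fin 5 → V := ![a, b, c, d, e]
  have key : Pent G (w : ZMod 5 → V) := by
    constructor
    · intro (i : Fin 5) (j : Fin 5) h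
      fin_cases i <;> fin_cases j <;> first | rfl | (exfalso; simp [w] at h; grind)
    · intro (i : Fin 5)
      fin_cases i
      · exact hab
      · exact hbc
      · exact hcd
      · exact hde
      · exact hea
  exact ⟨w, key, rfl, rfl, rfl, rfl, rfl⟩

end Pentagraph

namespace Pentagraph

variable {V : Type*}

lemma z5a : ∀ i : ZMod 5, i ≠ i + 2 := by decide
lemma z5b : ∀ i : ZMod 5, i + 1 ≠ i := by decide
lemma z5c : ∀ i : ZMod 5, i + 2 + ((3 : ℕ) : ZMod 5) = i := by decide
lemma z5d : ∀ i : ZMod 5, 0 - (-(i + 2) + ((2 : ℕ) : ZMod 5)) = i := by decide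

/-- standing assumptions for a counterexample -/
structure Ctx (G : SimpleGraph V) : Prop where
  c3 : ∀ a b c, G.Adj a b → G.Adj b c → G.Adj c a → False
  c4 : ∀ a b c d, G.Adj a b → G.Adj b c → G.Adj c d → G.Adj d a → a ≠ c → b ≠ d → False
  hole : ∀ n : ℕ, Odd n → 7 ≤ n → ¬ G.HasHole n
  share : ∀ v w, Pent G v → Pent G w → v 0 = w 0 → v 1 = w 1 → ∀ i, ∃ j, w i = v j

/-- `x` is not on the pentagon -/
def Out (v : ZMod 5 → V) (x : V) : Prop := ∀ i, x ≠ v i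

variable {G : SimpleGraph V} {v : ZMod 5 → V}

lemma adj_pent (hG : Ctx G) (hv : Pent G v) (i j : ZMod 5) :
    G.Adj (v i) (v j) ↔ (j = i + 1 ∨ i = j + 1) := by
  constructor
  · intro h
    rcases z5 i j with h1 | h1 | h1 | h1 | h1
    · subst h1; exact absurd h (G.loopless.irrefl _)
    · exact Or.inl h1
    · exact Or.inr h1
    · exfalso
      subst h1
      have h2 := hv.2 (i + 1)
      rw [show i + 1 + 1 = i + 2 by ring] at h2
      exact hG.c3 _ _ _ (hv.2 i) h2 h.symm
    · exfalso
      subst h1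
      have h2 := hv.2 (j + 1)
      rw [show j + 1 + 1 = j + 2 by ring] at h2
      exact hG.c3 _ _ _ (hv.2 j) h2 h
  · rintro (h | h)
    · subst h; exact hv.2 i
    · subst h; exact (hv.2 j).symm

lemma uniq_aux (hG : Ctx G) (hv : Pent G v) {x : V} (hx : Out v x) {i : ZMod 5}
    (hi : G.Adj x (v i)) : ¬ G.Adj x (v (i + 1)) ∧ ¬ G.Adj x (v (i + 2)) := by
  constructor
  · intro h
    exact hG.c3 _ _ _ hi (hv.2 i) h.symm
  · intro h
    have h2 := hv.2 (i + 1)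
    rw [show i + 1 + 1 = i + 2 by ring] at h2
    refine hG.c4 _ _ _ _ hi (hv.2 i) h2 h.symm (hx _) (fun h => ?_)
    exact z5a _ (hv.1 h)

lemma uniq (hG : Ctx G) (hv : Pent G v) {x : V} (hx : Out v x) {i j : ZMod 5}
    (hi : G.Adj x (v i)) (hj : G.Adj x (v j)) : i = j := by
  rcases z5 i j with h1 | h1 | h1 | h1 | h1
  · exact h1.symm
  · subst h1; exact absurd hj (uniq_aux hG hv hx hi).1
  · subst h1; exact absurd hi (uniq_aux hG hv hx hj).1
  · subst h1; exact absurd hj (uniq_aux hG hv hx hi).2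
  · subst h1; exact absurd hi (uniq_aux hG hv hx hj).2

/-- a pentagon sharing the edge `v i, v (i+1)` stays on `v` -/
lemma share' (hG : Ctx G) (hv : Pent G v) (i : ZMod 5) {c d e : V}
    (hbc : G.Adj (v (i + 1)) c) (hcd : G.Adj c d) (hde : G.Adj d e) (hea : G.Adj e (v i))
    (h1 : v i ≠ c) (h2 : v i ≠ d) (h3 : v (i + 1) ≠ d) (h4 : v (i + 1) ≠ e) (h5 : c ≠ e) :
    ¬ Out v d := by
  intro hd
  obtain ⟨w, hw, w0, w1, w2, w3, w4⟩ := pent_mk (hv.2 i) hbc hcd hde hea h1 h2 h3 h4 h5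
  obtain ⟨j, hj⟩ := hG.share _ w (hv.rot i) hw (by simp [w0]) (by simp [w1, add_comm]) 3
  rw [w3] at hj
  exact hd _ hj

lemma L1_aux (hG : Ctx G) (hv : Pent G v) {x y : V} (hx : Out v x) (hy : Out v y) {i : ZMod 5}
    (hi : G.Adj x (v i)) (hxy : G.Adj x y) :
    ¬ G.Adj y (v (i + 1)) ∧ ¬ G.Adj y (v (i + 2)) := by
  constructor
  · intro h
    exact hG.c4 _ _ _ _ hi (hv.2 i) h.symm hxy.symm (hx _) (hy _).symm
  · intro h
    have h2 := hv.2 (i + 1)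
    rw [show i + 1 + 1 = i + 2 by ring] at h2
    have h3 : i ≠ i + 2 := z5a i
    exact share' hG hv i h2 h.symm hxy.symm hi (fun h => h3 (hv.1 h)) (hy _).symm (hy _).symm
      (hx _).symm (hx _).symm hy

/-- coloured vertices are pairwise nonadjacent -/
lemma L1 (hG : Ctx G) (hv : Pent G v) {x y : V} (hx : Out v x) (hy : Out v y) {i j : ZMod 5}
    (hi : G.Adj x (v i)) (hj : G.Adj y (v j)) : ¬ G.Adj x y := by
  intro hxy
  rcases z5 i j with h1 | h1 | h1 | h1 | h1
  · subst h1; exact hG.c3 _ _ _ hxy hj hi.symm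
  · subst h1; exact (L1_aux hG hv hx hy hi hxy).1 hj
  · subst h1; exact (L1_aux hG hv hy hx hj hxy.symm).1 hi
  · subst h1; exact (L1_aux hG hv hx hy hi hxy).2 hj
  · subst h1; exact (L1_aux hG hv hy hx hj hxy.symm).2 hi

lemma z5cast (i : ZMod 5) (a b : ℕ) (ha : a ≤ 3) (hb : b ≤ 3) :
    ((i + (a : ZMod 5) = i + (b : ZMod 5)) ↔ a = b) ∧
    ((i + (a : ZMod 5) = i + (b : ZMod 5) + 1) ↔ a = b + 1) := by
  rw [add_assoc, add_right_inj, add_right_inj]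
  interval_cases a <;> interval_cases b <;> decide

/-- closing an induced path with an arc of the pentagon -/
lemma arc (hG : Ctx G) (hv : Pent G v) {f : ℕ → V} {n m : ℕ} (hf : IP G f n)
    (hout : ∀ t ≤ n, Out v (f t)) (i : ZMod 5) (hm : m ≤ 3) (hn : G.Adj (f n) (v i))
    (h0 : G.Adj (f 0) (v (i + (m : ZMod 5))))
    (hinner : ∀ t, 0 < t → t < n → ∀ b ≤ m, ¬ G.Adj (f t) (v (i + (b : ZMod 5))))
    (h7 : 7 ≤ n + m + 2) : ¬ Odd (n + m + 2) := by
  apply close_hole G hG.hole hf (r := fun t => v (i + (t : ZMod 5))) _ _ _ h7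
  · refine ⟨fun a ha b hb h => ?_, fun a ha b hb => ?_⟩
    · exact (z5cast i a b (by omega) (by omega)).1.1 (hv.1 h)
    · rw [adj_pent hG hv, (z5cast i b a (by omega) (by omega)).2,
        (z5cast i a b (by omega) (by omega)).2]
      omega
  · intro a ha b hb
    exact hout a ha _
  · intro a ha b hb
    constructor
    · intro h
      by_cases h1 : a = n
      · subst h1
        have := uniq hG hv (hout _ ha) h hn
        have h2 := (z5cast i b 0 (by omega) (by omega)).1.1 (by simpa using this)
        exact Or.inl ⟨rfl, h2⟩
      · by_cases h2 : a = 0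
        · subst h2
          have := uniq hG hv (hout _ ha) h h0
          exact Or.inr ⟨rfl, (z5cast i b m (by omega) (by omega)).1.1 this⟩
        · exact absurd h (hinner a (by omega) (by omega) b hb)
    · rintro (⟨rfl, rfl⟩ | ⟨rfl, rfl⟩)
      · simpa using hn
      · exact h0

/-- ends of colours `i`, `i+2`; interior coloured only `i+1` -/
lemma F3 (hG : Ctx G) (hv : Pent G v) {f : ℕ → V} {n : ℕ} (hf : IP G f n)
    (hout : ∀ t ≤ n, Out v (f t)) (i : ZMod 5) (h0 : G.Adj (f 0) (v i))
    (hn : G.Adj (f n) (v (i + 2)))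
    (hinner : ∀ t, 0 < t → t < n → ∀ j, G.Adj (f t) (v j) → j = i + 1) : Odd n := by
  by_contra hodd
  rw [Nat.not_odd_iff_even] at hodd
  have hn0 : n ≠ 0 := by
    rintro rfl
    have := uniq hG hv (hout 0 le_rfl) h0 hn
    exact z5a _ this
  obtain ⟨k, hk⟩ := hodd
  refine arc hG hv hf hout (i + 2) (m := 3) le_rfl hn ?_ ?_ (by omega) ⟨k + 2, by omega⟩
  · rwa [z5c]
  · intro t ht htn b hb h
    have := hinner t ht htn _ h
    clear h h0 hn hinner
    revert this
    interval_cases b <;> revert i <;> decide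

lemma F1 (hG : Ctx G) (hv : Pent G v) {f : ℕ → V} {n : ℕ} (hf : IP G f n)
    (hout : ∀ t ≤ n, Out v (f t)) (i : ZMod 5) (h0 : G.Adj (f 0) (v i))
    (hn : G.Adj (f n) (v (i + 2)))
    (hinner : ∀ t, 0 < t → t < n → ∀ j, ¬ G.Adj (f t) (v j)) : False := by
  have hodd := F3 hG hv hf hout i h0 hn (fun t h1 h2 j h => absurd h (hinner t h1 h2 j))
  obtain ⟨k, hk⟩ := hodd
  by_cases h1 : n = 1
  · subst h1
    refine L1 hG hv (hout 0 (by omega)) (hout 1 le_rfl) h0 hn ?_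
    exact (hf.2 0 (by omega) 1 le_rfl).2 (by omega)
  · have hv' := hv.refl 0
    refine arc hG hv' hf (fun t ht j => hout t ht _) (-(i + 2)) (m := 2) (by omega) ?_ ?_ ?_
      (by omega) ⟨k + 2, by omega⟩
    · simpa using hn
    · rwa [z5d]
    · intro t h1 h2 b hb
      exact hinner t h1 h2 _

lemma F1' (hG : Ctx G) (hv : Pent G v) {f : ℕ → V} {n : ℕ} (hf : IP G f n)
    (hout : ∀ t ≤ n, Out v (f t)) (i : ZMod 5) (h0 : G.Adj (f 0) (v (i + 2)))
    (hn : G.Adj (f n) (v i))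
    (hinner : ∀ t, 0 < t → t < n → ∀ j, ¬ G.Adj (f t) (v j)) : False := by
  refine F1 hG (hv.refl 0) hf (fun t ht j => hout t ht _) (-(i + 2)) (by simpa using h0) ?_
    (fun t h1 h2 j => hinner t h1 h2 _)
  rwa [show 0 - (-(i + 2) + 2) = i by ring]

/-- ends of colours `i+1`, `i` -/
lemma F2 (hG : Ctx G) (hv : Pent G v) {f : ℕ → V} {n : ℕ} (hf : IP G f n)
    (hout : ∀ t ≤ n, Out v (f t)) (i : ZMod 5) (h0 : G.Adj (f 0) (v (i + 1)))
    (hn : G.Adj (f n) (v i))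
    (hinner : ∀ t, 0 < t → t < n → ∀ j, ¬ G.Adj (f t) (v j)) : Odd n := by
  by_contra hodd
  rw [Nat.not_odd_iff_even] at hodd
  have hn0 : n ≠ 0 := by
    rintro rfl
    have := uniq hG hv (hout 0 le_rfl) h0 hn
    exact z5b _ this
  obtain ⟨k, hk⟩ := hodd
  by_cases h2 : n = 2
  · subst h2
    have a01 : G.Adj (f 0) (f 1) := (hf.2 0 (by omega) 1 (by omega)).2 (by omega)
    have a12 : G.Adj (f 1) (f 2) := (hf.2 1 (by omega) 2 (by omega)).2 (by omega)
    refine share' hG hv i h0.symm a01 a12 hn ?_ ?_ ?_ ?_ ?_ (hout 1 (by omega))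
    · exact (hout 0 (by omega) _).symm
    · exact (hout 1 (by omega) _).symm
    · exact (hout 1 (by omega) _).symm
    · exact (hout 2 (by omega) _).symm
    · intro h
      have := hf.1 0 (by omega) 2 (by omega) h
      omega
  · refine arc hG hv hf hout i (m := 1) (by omega) hn (by simpa using h0) ?_ (by omega)
      ⟨k + 1, by omega⟩
    intro t h1 h2 b hb
    exact hinner t h1 h2 _

/-- ends of the same colour -/
lemma F0 (hG : Ctx G) (hv : Pent G v) {f : ℕ → V} {n : ℕ} (hf : IP G f n)
    (hout : ∀ t ≤ n, Out v (f t)) (i : ZMod 5) (h0 : G.Adj (f 0) (v i))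
    (hn : G.Adj (f n) (v i))
    (hinner : ∀ t, 0 < t → t < n → ∀ j, ¬ G.Adj (f t) (v j)) (hodd : Odd n) : n = 3 := by
  obtain ⟨k, hk⟩ := hodd
  by_contra h3
  by_cases h1 : n = 1
  · subst h1
    refine L1 hG hv (hout 0 (by omega)) (hout 1 le_rfl) h0 hn ?_
    exact (hf.2 0 (by omega) 1 le_rfl).2 (by omega)
  · refine arc hG hv hf hout i (m := 0) (by omega) hn (by simpa using h0) ?_ (by omega)
      ⟨k + 1, by omega⟩
    intro t h1 h2 b hb
    exact hinner t h1 h2 _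

lemma L2_aux (hG : Ctx G) (hv : Pent G v) {x y a : V} (hx : Out v x) (hy : Out v y)
    (ha : Out v a) {i : ZMod 5} (hi : G.Adj x (v i)) (hxa : G.Adj x a) (hya : G.Adj y a)
    (hxy : x ≠ y) : ¬ G.Adj y (v (i + 1)) ∧ ¬ G.Adj y (v (i + 2)) := by
  constructor
  · intro h
    exact share' hG hv i h.symm hya hxa.symm hi (hy _).symm (ha _).symm (ha _).symm (hx _).symm
      hxy.symm ha
  · intro h
    have hn : ¬ G.Adj x y := L1 hG hv hx hy hi h
    let f : ℕ → V := fun t => if t = 0 then x else if t = 1 then a else y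
    have hf : IP G f 2 := by
      have e1 := hxa.ne
      have e2 := hya.ne
      have hn' : ¬ G.Adj y x := fun h => hn h.symm
      refine ⟨fun p hp q hq => ?_, fun p hp q hq => ?_⟩
      · interval_cases p <;> interval_cases q <;> simp [f, hxy, e1, e2, hxy.symm, e1.symm, e2.symm]
      · interval_cases p <;> interval_cases q <;>
          simp [f, hxa, hya, hn, hn', hxa.symm, hya.symm]
    refine F1 hG hv hf ?_ i (by simpa [f] using hi) (by simpa [f] using h) ?_
    · intro t ht
      interval_cases t
      · simpa [f] using hx
      · simpa [f] using ha
      · simpa [f] using hy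
    · intro t h1 h2 j h
      have : t = 1 := by omega
      subst this
      exact L1 hG hv hx ha hi (by simpa [f] using h) hxa

lemma L2 (hG : Ctx G) (hv : Pent G v) {x y a : V} (hx : Out v x) (hy : Out v y)
    (ha : Out v a) {i j : ZMod 5} (hi : G.Adj x (v i)) (hj : G.Adj y (v j)) (hxy : x ≠ y)
    (hxa : G.Adj x a) (hya : G.Adj y a) : False := by
  rcases z5 i j with h1 | h1 | h1 | h1 | h1
  · subst h1; exact hG.c4 _ _ _ _ hi hj.symm hya hxa.symm hxy (ha _).symm
  · subst h1; exact (L2_aux hG hv hx hy ha hi hxa hya hxy).1 hj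
  · subst h1; exact (L2_aux hG hv hy hx ha hj hya hxa hxy.symm).1 hi
  · subst h1; exact (L2_aux hG hv hx hy ha hi hxa hya hxy).2 hj
  · subst h1; exact (L2_aux hG hv hy hx ha hj hya hxa hxy.symm).2 hi

end Pentagraph

namespace Pentagraph

variable {V : Type*} {G : SimpleGraph V} {v : ZMod 5 → V}

lemma F3' (hG : Ctx G) (hv : Pent G v) {f : ℕ → V} {n : ℕ} (hf : IP G f n)
    (hout : ∀ t ≤ n, Out v (f t)) (i : ZMod 5) (h0 : G.Adj (f 0) (v (i + 2)))
    (hn : G.Adj (f n) (v i))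
    (hinner : ∀ t, 0 < t → t < n → ∀ j, G.Adj (f t) (v j) → j = i + 1) : Odd n := by
  refine F3 hG (hv.refl 0) hf (fun t ht j => hout t ht _) (-(i + 2)) (by simpa using h0) ?_ ?_
  · rwa [show 0 - (-(i + 2) + 2) = i by ring]
  · intro t h1 h2 j h
    have := hinner t h1 h2 _ h
    linear_combination -this

lemma next_col (P : ℕ → Prop) (t n : ℕ) (h : t < n) (hn : P n) :
    ∃ d, 0 < d ∧ t + d ≤ n ∧ P (t + d) ∧ ∀ r, 0 < r → r < d → ¬ P (t + r) := by
  classical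
  have hex : ∃ d, 0 < d ∧ P (t + d) := ⟨n - t, by omega, by rwa [show t + (n - t) = n by omega]⟩
  refine ⟨Nat.find hex, (Nat.find_spec hex).1, ?_, (Nat.find_spec hex).2, ?_⟩
  · have := Nat.find_min' hex (m := n - t) ⟨by omega, by rwa [show t + (n - t) = n by omega]⟩
    omega
  · intro r hr hlt hP
    exact Nat.find_min hex hlt ⟨hr, hP⟩

/-- a jump from colour 3 to colour 1 contains a pentagon at `v 2` -/
lemma jump (hG : Ctx G) (hv : Pent G v) {g : ℕ → V} {n : ℕ} (hg : IP G g n)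
    (hout : ∀ t ≤ n, Out v (g t)) (h0 : G.Adj (g 0) (v 3)) (hn : G.Adj (g n) (v 1))
    (hinner : ∀ t, 0 < t → t < n → ∀ j, G.Adj (g t) (v j) → j = 2 ∨ j = 4) :
    ∃ s, s + 3 ≤ n ∧ G.Adj (g s) (v 2) ∧ G.Adj (g (s + 3)) (v 2) := by
  by_contra hcon
  push Not at hcon
  have hn0 : 0 < n := by
    rcases Nat.eq_zero_or_pos n with h | h
    · subst h
      exact absurd (uniq hG hv (hout 0 le_rfl) h0 hn) (by decide)
    · exact h
  have nxt : ∀ t < n, ∃ d, 0 < d ∧ t + d ≤ n ∧ (∃ j, G.Adj (g (t + d)) (v j)) ∧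
      ∀ r, 0 < r → r < d → ∀ j, ¬ G.Adj (g (t + r)) (v j) := by
    intro t ht
    obtain ⟨d, h1, h2, h3, h4⟩ := next_col (fun s => ∃ j, G.Adj (g s) (v j)) t n ht ⟨_, hn⟩
    exact ⟨d, h1, h2, h3, fun r hr hrd j hj => h4 r hr hrd ⟨j, hj⟩⟩
  -- no colour 4
  have no4 : ∀ k t, n - t = k → 0 < t → t < n → ¬ G.Adj (g t) (v 4) := by
    intro k
    induction k using Nat.strong_induction_on with
    | _ k ih =>
      intro t hk ht htn h4
      obtain ⟨d, hd, hdn, ⟨j, hj⟩, hclean⟩ := nxt t htn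
      have hsub := hg.sub t d hdn
      have hso : ∀ r ≤ d, Out v (g (t + r)) := fun r hr => hout _ (by omega)
      rcases Nat.lt_or_ge (t + d) n with hlt | hge
      · rcases hinner (t + d) (by omega) hlt j hj with rfl | rfl
        · exact F1' hG hv hsub hso 2 h4 hj hclean
        · exact ih (n - (t + d)) (by omega) (t + d) rfl (by omega) hlt hj
      · have e : t + d = n := by omega
        exact F1 hG hv hsub hso 4 h4 (by rw [e]; exact hn) hclean
  have only2 : ∀ t, 0 < t → t < n → ∀ j, G.Adj (g t) (v j) → j = 2 := by
    intro t h1 h2 j hj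
    rcases hinner t h1 h2 j hj with h | h
    · exact h
    · subst h; exact absurd hj (no4 _ t rfl h1 h2)
  have hodd : Odd n := F3' hG hv hg hout 1 h0 hn only2
  have par : ∀ k t, n - t = k → 0 < t → t < n → G.Adj (g t) (v 2) → Odd (n - t) := by
    intro k
    induction k using Nat.strong_induction_on with
    | _ k ih =>
      intro t hk ht htn h2
      obtain ⟨d, hd, hdn, ⟨j, hj⟩, hclean⟩ := nxt t htn
      have hsub := hg.sub t d hdn
      have hso : ∀ r ≤ d, Out v (g (t + r)) := fun r hr => hout _ (by omega)
      rcases Nat.lt_or_ge (t + d) n with hlt | hge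
      · have := only2 (t + d) (by omega) hlt j hj
        subst this
        have o1 := ih (n - (t + d)) (by omega) (t + d) rfl (by omega) hlt hj
        rcases Nat.even_or_odd d with he | ho
        · obtain ⟨p, hp⟩ := o1
          obtain ⟨q, hq⟩ := he
          exact ⟨p + q, by omega⟩
        · have d3 := F0 hG hv hsub hso 2 h2 hj hclean ho
          subst d3
          exact absurd hj (hcon t hdn h2)
      · have e : t + d = n := by omega
        have := F2 hG hv hsub hso 1 h2 (by rw [e]; exact hn) hclean
        rwa [show n - t = d by omega]
  obtain ⟨d, hd, hdn, ⟨j, hj⟩, hclean⟩ := nxt 0 hn0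
  have hsub := hg.sub 0 d hdn
  have hso : ∀ r ≤ d, Out v (g (0 + r)) := fun r hr => hout _ (by omega)
  rcases Nat.lt_or_ge (0 + d) n with hlt | hge
  · have := only2 (0 + d) (by omega) hlt j hj
    subst this
    obtain ⟨p, hp⟩ := par _ (0 + d) rfl (by omega) hlt hj
    obtain ⟨q, hq⟩ := F2 hG hv hsub hso 2 h0 hj hclean
    obtain ⟨r, hr⟩ := hodd
    omega
  · have e : 0 + d = n := by omega
    exact F1' hG hv hsub hso 1 h0 (by rw [e]; exact hn) hclean

/-- a connected set with no vertex in or adjacent to the pentagon -/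
def Good (G : SimpleGraph V) (v : ZMod 5 → V) (U : Finset V) : Prop :=
  Pent G v ∧ U.Nonempty ∧ (∀ u ∈ U, Out v u ∧ ∀ i, ¬ G.Adj u (v i)) ∧
    ∀ p ∈ U, ∀ q ∈ U, Rch G (U : Set V) p q

lemma Good.rot {U : Finset V} (h : Good G v U) (k : ZMod 5) : Good G (fun i => v (i + k)) U :=
  ⟨h.1.rot k, h.2.1, fun u hu => ⟨fun i => (h.2.2.1 u hu).1 _, fun i => (h.2.2.1 u hu).2 _⟩,
    h.2.2.2⟩

lemma Good.refl {U : Finset V} (h : Good G v U) (k : ZMod 5) : Good G (fun i => v (k - i)) U :=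
  ⟨h.1.refl k, h.2.1, fun u hu => ⟨fun i => (h.2.2.1 u hu).1 _, fun i => (h.2.2.1 u hu).2 _⟩,
    h.2.2.2⟩

lemma conn_insert [DecidableEq V] {U : Finset V} (hU : ∀ p ∈ U, ∀ q ∈ U, Rch G (U : Set V) p q)
    {u z : V} (hu : u ∈ U) (huz : G.Adj u z) :
    ∀ p ∈ insert z U, ∀ q ∈ insert z U, Rch G ((insert z U : Finset V) : Set V) p q := by
  have key : ∀ p ∈ insert z U, Rch G ((insert z U : Finset V) : Set V) u p := by
    intro p hp
    rcases Finset.mem_insert.1 hp with rfl | hp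
    · exact Relation.ReflTransGen.single ⟨huz, by simp [hu], by simp⟩
    · exact (hU u hu p hp).mono (by simp)
  intro p hp q hq
  exact (key p hp).symm.trans (key q hq)

/-- the colours seen by `U` have no two at distance two -/
lemma types (hG : Ctx G) {U : Finset V} (h : Good G v U) {z z' u u' : V} (hz : Out v z)
    (hz' : Out v z') (hu : u ∈ U) (hu' : u' ∈ U) (huz : G.Adj u z) (huz' : G.Adj u' z')
    (i : ZMod 5) (hi : G.Adj z (v i)) (hi' : G.Adj z' (v (i + 2))) : False := by
  classical
  obtain ⟨hv, hne, hUC, hconn⟩ := h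
  have r1 := conn_insert (conn_insert hconn hu huz) (Finset.mem_insert_of_mem hu') huz'
  obtain ⟨n, f, hf, hA, hB, hS, hA', hB'⟩ := minpath G (A := {z}) (B := {z'})
    (Set.mem_singleton z) (Set.mem_singleton z') (by simp)
    (r1 z (by simp) z' (by simp))
  simp only [Set.mem_singleton_iff, Finset.coe_insert, Set.mem_insert_iff, Finset.mem_coe] at *
  refine F1 hG hv hf ?_ i (by rw [hA]; exact hi) (by rw [hB]; exact hi') ?_
  · intro t ht
    rcases hS t ht with h | h | h
    · rwa [h]
    · rwa [h]
    · exact (hUC _ h).1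
  · intro t h1 h2 j
    rcases hS t h2.le with h | h | h
    · exact absurd h (hB' t h2)
    · exact absurd h (hA' t h1 h2.le)
    · exact (hUC _ h).2 j

/-- The enlarging step. -/
lemma enlarge (hG : Ctx G) {U : Finset V} (h : Good G v U)
    (hmax : ∀ v' U', Good G v' U' → U'.card ≤ U.card)
    (hty : ∀ z, Out v z → ∀ u ∈ U, G.Adj u z → ∀ j, G.Adj z (v j) → j = 0 ∨ j = 1)
    {u z : V} (hu : u ∈ U) (hzU : z ∉ U) (huz : G.Adj u z)
    {g : ℕ → V} {n : ℕ} (hg : IP G g n)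
    (hout : ∀ t ≤ n, Out v (g t)) (h0 : G.Adj (g 0) (v 3)) (hn : G.Adj (g n) (v 1))
    (hinner : ∀ t, 0 < t → t < n → ∀ j, G.Adj (g t) (v j) → j = 2 ∨ j = 4) : False := by
  classical
  obtain ⟨hv, hne, hUC, hconn⟩ := h
  have absorb : ∀ a u, u ∈ U → a ∉ U → G.Adj u a → ∃ j, G.Adj a (v j) := by
    intro a u hu ha hua
    by_contra hc
    push Not at hc
    have haO : Out v a := by
      intro i hi
      subst hi
      exact (hUC u hu).2 i hua
    have := hmax v (insert a U) ⟨hv, by simp, ?_, conn_insert hconn hu hua⟩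
    · rw [Finset.card_insert_of_notMem ha] at this
      omega
    · intro w hw
      rcases Finset.mem_insert.1 hw with rfl | hw
      · exact ⟨haO, hc⟩
      · exact hUC w hw
  obtain ⟨s, hs, hx, hy⟩ := jump hG hv hg hout h0 hn hinner
  have ox := hout s (by omega)
  have oa := hout (s + 1) (by omega)
  have ob := hout (s + 2) (by omega)
  have oy := hout (s + 3) (by omega)
  have axa : G.Adj (g s) (g (s + 1)) := (hg.2 _ (by omega) _ (by omega)).2 (by omega)
  have aab : G.Adj (g (s + 1)) (g (s + 2)) := (hg.2 _ (by omega) _ (by omega)).2 (by omega)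
  have aby : G.Adj (g (s + 2)) (g (s + 3)) := (hg.2 _ (by omega) _ (by omega)).2 (by omega)
  have nxb : g s ≠ g (s + 2) := fun h => by
    have := hg.1 _ (by omega) _ (by omega) h
    omega
  have nxy : g s ≠ g (s + 3) := fun h => by
    have := hg.1 _ (by omega) _ (by omega) h
    omega
  have nay : g (s + 1) ≠ g (s + 3) := fun h => by
    have := hg.1 _ (by omega) _ (by omega) h
    omega
  generalize g s = x at *
  generalize g (s + 1) = a at *
  generalize g (s + 2) = b at *
  generalize g (s + 3) = y at *
  have ca : ∀ j, ¬ G.Adj a (v j) := fun j hj => L1 hG hv ox oa hx hj axa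
  have cb : ∀ j, ¬ G.Adj b (v j) := fun j hj => L1 hG hv oy ob hy hj aby.symm
  obtain ⟨w, hw, w0, w1, w2, w3, w4⟩ := pent_mk hx.symm axa aab aby hy (oa _).symm (ob _).symm
    nxb nxy nay
  have nb : ∀ p ∈ U, ∀ q, Out v q → G.Adj q (v 2) → ¬ G.Adj p q := by
    intro p hp q hq hq2 hpq
    rcases hty q hq p hp hpq 2 hq2 with h | h <;> exact absurd h (by decide)
  have haU : a ∉ U := fun h => nb a h x ox hx axa.symm
  have hbU : b ∉ U := fun h => nb b h y oy hy aby
  have hzO : Out v z := by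
    intro i hi
    subst hi
    exact (hUC u hu).2 i huz
  obtain ⟨j, hzj⟩ := absorb z u hu hzU huz
  have hj := hty z hzO u hu huz j hzj
  have hj2 : j ≠ 2 := by rintro rfl; revert hj; decide
  have hz2 : ¬ G.Adj z (v 2) := fun h => hj2 (uniq hG hv hzO hzj h)
  have hzx : z ≠ x := by rintro rfl; exact hz2 hx
  have hzy : z ≠ y := by rintro rfl; exact hz2 hy
  have hza : z ≠ a := by rintro rfl; exact ca _ hzj
  have hzb : z ≠ b := by rintro rfl; exact cb _ hzj
  have nzx : ¬ G.Adj z x := L1 hG hv hzO ox hzj hx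
  have nzy : ¬ G.Adj z y := L1 hG hv hzO oy hzj hy
  have nza : ¬ G.Adj z a := fun h => L2 hG hv hzO ox oa hzj hx hzx h axa
  have nzb : ¬ G.Adj z b := fun h => L2 hG hv hzO oy ob hzj hy hzy h aby.symm
  have five : ∀ i : ZMod 5, i = 0 ∨ i = 1 ∨ i = 2 ∨ i = 3 ∨ i = 4 := by decide
  have := hmax w (insert z U) ⟨hw, by simp, ?_, conn_insert hconn hu huz⟩
  · rw [Finset.card_insert_of_notMem hzU] at this
    omega
  · intro p hp
    have key : (p ≠ v 2 ∧ p ≠ x ∧ p ≠ a ∧ p ≠ b ∧ p ≠ y) ∧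
        (¬ G.Adj p (v 2) ∧ ¬ G.Adj p x ∧ ¬ G.Adj p a ∧ ¬ G.Adj p b ∧ ¬ G.Adj p y) := by
      rcases Finset.mem_insert.1 hp with rfl | hp
      · exact ⟨⟨hzO 2, hzx, hza, hzb, hzy⟩, hz2, nzx, nza, nzb, nzy⟩
      · refine ⟨⟨(hUC p hp).1 2, ?_, ?_, ?_, ?_⟩, (hUC p hp).2 2, nb p hp x ox hx, ?_, ?_,
          nb p hp y oy hy⟩
        · rintro rfl; exact (hUC p hp).2 2 hx
        · rintro rfl; exact haU hp
        · rintro rfl; exact hbU hp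
        · rintro rfl; exact (hUC p hp).2 2 hy
        · intro h
          obtain ⟨k, hk⟩ := absorb a p hp haU h
          exact ca k hk
        · intro h
          obtain ⟨k, hk⟩ := absorb b p hp hbU h
          exact cb k hk
    obtain ⟨⟨k0, k1, k2, k3, k4⟩, m0, m1, m2, m3, m4⟩ := key
    constructor
    · intro i
      rcases five i with rfl | rfl | rfl | rfl | rfl
      · rwa [w0]
      · rwa [w1]
      · rwa [w2]
      · rwa [w3]
      · rwa [w4]
    · intro i
      rcases five i with rfl | rfl | rfl | rfl | rfl
      · rwa [w0]
      · rwa [w1]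
      · rwa [w2]
      · rwa [w3]
      · rwa [w4]

lemma type_set (T : ZMod 5 → Prop) (h : ∀ i, T i → T (i + 2) → False) :
    ∃ i, ∀ j, T j → j = i ∨ j = i + 1 := by
  by_cases h0 : ∃ j, T j
  · obtain ⟨j, hj⟩ := h0
    by_cases h1 : T (j + 1)
    · refine ⟨j, fun k hk => ?_⟩
      rcases z5 j k with e | e | e | e | e
      · exact Or.inl e
      · exact Or.inr e
      · exfalso
        subst e
        exact h k hk (by rwa [show k + 1 + 1 = k + 2 by ring] at h1)
      · subst e; exact absurd hk (h j hj)
      · subst e; exact absurd hj (h k hk)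
    · refine ⟨j - 1, fun k hk => ?_⟩
      rcases z5 j k with e | e | e | e | e
      · right; rw [e]; ring
      · subst e; exact absurd hk h1
      · left; rw [e]; ring
      · subst e; exact absurd hk (h j hj)
      · subst e; exact absurd hj (h k hk)
  · exact ⟨0, fun j hj => absurd ⟨j, hj⟩ h0⟩

end Pentagraph

namespace Pentagraph

variable {V : Type*} {G : SimpleGraph V} {v : ZMod 5 → V}

lemma leave {S : Set V} {U : Finset V} {a b : V} (h : Rch G S a b) (ha : a ∈ U) (hb : b ∉ U) :
    ∃ p ∈ U, ∃ q, q ∉ U ∧ G.Adj p q := by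
  induction h with
  | refl => exact absurd ha hb
  | @tail b c _ hbc ih =>
    by_cases h : b ∈ U
    · exact ⟨b, h, c, hb, hbc.1⟩
    · exact ih h

lemma five : ∀ i : ZMod 5, i = 0 ∨ i = 1 ∨ i = 2 ∨ i = 3 ∨ i = 4 := by decide
lemma refl_ty : ∀ j : ZMod 5, (1 - j = 0 ∨ 1 - j = 1) → (j = 0 ∨ j = 1) := by decide
lemma refl_int : ∀ j : ZMod 5, (1 - j = 2 ∨ 1 - j = 4) → (j = 2 ∨ j = 4) := by decide

lemma out_nbr [Fintype V] (hG : Ctx G) (h3c : G.ThreeConnected) (hv : Pent G v) :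
    ∃ x, Out v x ∧ G.Adj x (v 3) := by
  have hc := h3c.2 {v 2, v 4} (by
    rw [Set.ncard_pair (fun h => absurd (hv.1 h) (by decide))])
  have m3 : v 3 ∈ ({v 2, v 4} : Set V)ᶜ := by
    simp only [Set.mem_compl_iff, Set.mem_insert_iff, Set.mem_singleton_iff, hv.1.eq_iff]
    decide
  have m0 : v 0 ∈ ({v 2, v 4} : Set V)ᶜ := by
    simp only [Set.mem_compl_iff, Set.mem_insert_iff, Set.mem_singleton_iff, hv.1.eq_iff]
    decide
  have hr := rch_of_connected hc m3 m0
  rcases Relation.ReflTransGen.cases_head hr with h | ⟨x, ⟨hx, -, hx2⟩, -⟩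
  · exact absurd (hv.1 h) (by decide)
  · refine ⟨x, ?_, hx.symm⟩
    intro i hi
    subst hi
    rw [adj_pent hG hv] at hx
    apply hx2
    rcases hx with h | h
    · right
      rw [h]
      rfl
    · left
      have : i = 2 := by linear_combination -h
      rw [this]

lemma finish [Fintype V] (hG : Ctx G) (h3c : G.ThreeConnected)
    (hstable : ∀ X : Set V, X.ncard = 3 → G.IsCutset X → ∀ a ∈ X, ∀ b ∈ X, ¬ G.Adj a b)
    (hv : Pent G v) : False := by
  classical
  -- a good pair exists
  have hgood : ∃ U, Good G v U := by
    obtain ⟨x, hx, hx3⟩ := out_nbr hG h3c hv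
    have hc := h3c.2 {v 3} (by simp)
    have hr := rch_of_connected (a := x) (b := v 0) hc (by simpa using hx 3)
      (by simp only [Set.mem_compl_iff, Set.mem_singleton_iff, hv.1.eq_iff]; decide)
    rcases Relation.ReflTransGen.cases_head hr with h | ⟨u, ⟨hu, -, hu2⟩, -⟩
    · exact absurd h (hx 0)
    · have hu3 : u ≠ v 3 := by simpa using hu2
      have huO : Out v u := by
        intro i hi
        subst hi
        exact hu3 (by rw [uniq hG hv hx hu hx3])
      refine ⟨{u}, hv, by simp, ?_, ?_⟩
      · intro w hw
        rw [Finset.mem_singleton.1 hw]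
        exact ⟨huO, fun i hi => L1 hG hv hx huO hx3 hi hu⟩
      · intro p hp q hq
        rw [Finset.mem_singleton.1 hp, Finset.mem_singleton.1 hq]
        exact Relation.ReflTransGen.refl
  obtain ⟨U0, hU0⟩ := hgood
  obtain ⟨⟨v', U⟩, hgd, hmax⟩ := Set.exists_max_image
    {p : (Fin 5 → V) × Finset V | Good G p.1 p.2} (fun p => p.2.card) (Set.toFinite _)
    ⟨(v, U0), hU0⟩
  clear hU0 hv
  have hmax' : ∀ v' U', Good G v' U' → U'.card ≤ U.card := fun a b hab => hmax (a, b) hab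
  clear hmax
  -- normalise the colours seen by `U`
  obtain ⟨i, hi⟩ := type_set
    (fun j => ∃ z u, Out (v' : ZMod 5 → V) z ∧ u ∈ U ∧ G.Adj u z ∧ G.Adj z (v' j)) (by
      rintro i ⟨z, u, hz, hu, huz, hzi⟩ ⟨z', u', hz', hu', huz', hzi'⟩
      exact types hG hgd hz hz' hu hu' huz huz' i hzi hzi')
  obtain ⟨v, hvU, hty⟩ : ∃ v : ZMod 5 → V, Good G v U ∧
      (∀ z, Out v z → ∀ u ∈ U, G.Adj u z → ∀ j, G.Adj z (v j) → j = 0 ∨ j = 1) := by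
    refine ⟨fun j => (v' : ZMod 5 → V) (j + i), Good.rot hgd i, ?_⟩
    intro z hz u hu huz j hj
    have hz' : Out (v' : ZMod 5 → V) z := by
      intro k
      have := hz (k - i)
      simpa using this
    rcases hi (j + i) ⟨z, u, hz', hu, huz, hj⟩ with h | h
    · left; linear_combination h
    · right; linear_combination h
  clear hi hgd
  have hv := hvU.1
  obtain ⟨u0, hu0⟩ := hvU.2.1
  have hv0U : v 0 ∉ U := fun h => (hvU.2.2.1 _ h).1 0 rfl
  obtain ⟨u, hu, z, hzU, huz⟩ : ∃ p ∈ U, ∃ q, q ∉ U ∧ G.Adj p q := by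
    have hc := h3c.2 ∅ (by simp)
    exact leave (rch_of_connected hc (a := u0) (b := v 0) (by simp) (by simp)) hu0 hv0U
  -- the path
  obtain ⟨x, hx, hx3⟩ := out_nbr hG h3c hv
  have n23 : v 2 ≠ v 3 := fun h => absurd (hv.1 h) (by decide)
  have n24 : v 2 ≠ v 4 := fun h => absurd (hv.1 h) (by decide)
  have n34 : v 3 ≠ v 4 := fun h => absurd (hv.1 h) (by decide)
  have hconn : (G.induce (({v 2, v 3, v 4} : Set V)ᶜ)).Connected := by
    by_contra hc
    refine hstable {v 2, v 3, v 4} ?_ hc (v 2) (by simp) (v 3) (by simp) (hv.2 2)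
    rw [Set.ncard_eq_three]
    exact ⟨_, _, _, n23, n24, n34, rfl⟩
  have hr := rch_of_connected hconn (a := x) (b := v 0)
    (by simp [hx 2, hx 3, hx 4])
    (by simp only [Set.mem_compl_iff, Set.mem_insert_iff, Set.mem_singleton_iff, hv.1.eq_iff]
        decide)
  have key : ∀ b, Rch G (({v 2, v 3, v 4} : Set V)ᶜ) x b →
      (Out v b ∧ Rch G {y | Out v y} x b) ∨
      ∃ y, (Out v y ∧ (G.Adj y (v 0) ∨ G.Adj y (v 1))) ∧ Rch G {y | Out v y} x y := by
    intro b hb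
    induction hb with
    | refl => exact Or.inl ⟨hx, Relation.ReflTransGen.refl⟩
    | @tail b c _ hbc ih =>
      rcases ih with ⟨hbO, hbR⟩ | h
      · by_cases hcO : Out v c
        · exact Or.inl ⟨hcO, hbR.tail ⟨hbc.1, hbO, hcO⟩⟩
        · right
          unfold Out at hcO
          push Not at hcO
          obtain ⟨k, rfl⟩ := hcO
          refine ⟨b, ⟨hbO, ?_⟩, hbR⟩
          have hm := hbc.2.2
          have ha := hbc.1
          rcases five k with rfl | rfl | rfl | rfl | rfl
          · exact Or.inl ha
          · exact Or.inr ha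
          · simp at hm
          · simp at hm
          · simp at hm
      · exact Or.inr h
  obtain ⟨y, hy, hxy⟩ : ∃ y, (Out v y ∧ (G.Adj y (v 0) ∨ G.Adj y (v 1))) ∧
      Rch G {y | Out v y} x y := by
    rcases key _ hr with h | h
    · exact absurd rfl (h.1 0)
    · exact h
  obtain ⟨n, g, hg, hA, hB, hS, hA', hB'⟩ := minpath G
    (A := {y | Out v y ∧ G.Adj y (v 3)}) (B := {y | Out v y ∧ (G.Adj y (v 0) ∨ G.Adj y (v 1))})
    (S := {y | Out v y}) ⟨hx, hx3⟩ hy hx hxy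
  have hinner : ∀ t, 0 < t → t < n → ∀ j, G.Adj (g t) (v j) → j = 2 ∨ j = 4 := by
    intro t h1 h2 j hj
    have hO : Out v (g t) := hS t h2.le
    rcases five j with rfl | rfl | rfl | rfl | rfl
    · exact absurd ⟨hO, Or.inl hj⟩ (hB' t h2)
    · exact absurd ⟨hO, Or.inr hj⟩ (hB' t h2)
    · exact Or.inl rfl
    · exact absurd ⟨hO, hj⟩ (hA' t h1 h2.le)
    · exact Or.inr rfl
  rcases hB.2 with hend | hend
  · refine enlarge hG (hvU.refl 1) hmax' ?_ hu hzU huz hg (fun t ht j => hS t ht _) hA.2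
      (by simpa using hend) ?_
    · intro z hz u hu huz j hj
      refine refl_ty j (hty z (fun k => ?_) u hu huz _ hj)
      have := hz (1 - k)
      simpa using this
    · intro t h1 h2 j hj
      exact refl_int j (hinner t h1 h2 _ hj)
  · exact enlarge hG hvU hmax' hty hu hzU huz hg hS hA.2 hend hinner

/-- a cycle from a pentagon -/
lemma pent_cycle (hv : Pent G v) : ∃ (a : V) (w : G.Walk a a), w.IsCycle ∧ w.length = 5 ∧
    (∀ e, e ∈ w.edges ↔ ∃ i, e = s(v i, v (i + 1))) := by
  obtain ⟨w, h1, h2, -, h4⟩ := cycle_of_seq G 4 (by omega) (fun t => v (t : ZMod 5))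
    (fun t _ => by simpa using hv.2 (t : ZMod 5)) (hv.2 4) (by
      intro a ha b hb hab
      have := hv.1 hab
      revert this
      clear hab
      interval_cases a <;> interval_cases b <;> decide)
  refine ⟨_, w, h1, h2, ?_⟩
  intro e
  rw [h4]
  constructor
  · rintro (h | ⟨t, -, h⟩)
    · exact ⟨4, h⟩
    · exact ⟨(t : ZMod 5), by simpa using h⟩
  · rintro ⟨i, h⟩
    rcases five i with rfl | rfl | rfl | rfl | rfl
    · exact Or.inr ⟨0, by omega, h⟩
    · exact Or.inr ⟨1, by omega, h⟩
    · exact Or.inr ⟨2, by omega, h⟩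
    · exact Or.inr ⟨3, by omega, h⟩
    · exact Or.inl h

lemma no_short (hg : G.egirth = (2 * 2 + 1 : ℕ)) {a : V} (w : G.Walk a a) (hw : w.IsCycle) :
    5 ≤ w.length := by
  have h := egirth_le_length hw
  rw [hg] at h
  exact_mod_cast h

lemma no3 (hg : G.egirth = (2 * 2 + 1 : ℕ)) (a b c : V) (h1 : G.Adj a b) (h2 : G.Adj b c)
    (h3 : G.Adj c a) : False := by
  have e1 := h1.ne
  have e2 := h2.ne
  have e3 := h3.ne
  have := no_short hg (Walk.cons h1 (Walk.cons h2 (Walk.cons h3 Walk.nil))) (by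
    rw [Walk.cons_isCycle_iff]
    simp [e1, e2, e3, e1.symm, e2.symm, e3.symm])
  simp at this

lemma no4 (hg : G.egirth = (2 * 2 + 1 : ℕ)) (a b c d : V) (h1 : G.Adj a b) (h2 : G.Adj b c)
    (h3 : G.Adj c d) (h4 : G.Adj d a) (hac : a ≠ c) (hbd : b ≠ d) : False := by
  have e1 := h1.ne
  have e2 := h2.ne
  have e3 := h3.ne
  have e4 := h4.ne
  have := no_short hg (Walk.cons h1 (Walk.cons h2 (Walk.cons h3 (Walk.cons h4 Walk.nil)))) (by
    rw [Walk.cons_isCycle_iff]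
    simp [e1, e2, e3, e4, e1.symm, e2.symm, e3.symm, e4.symm, hac, hac.symm, hbd, hbd.symm])
  simp at this

lemma pent_of_cycle {a : V} (w : G.Walk a a) (hw : w.IsCycle) (hl : w.length = 5) :
    ∃ v, Pent G v := by
  have hne : ∀ i j, i < 5 → j < 5 → w.getVert i = w.getVert j → i = j := by
    intro i j hi hj h
    exact hw.getVert_injOn' (by simp; omega) (by simp; omega) h
  have hadj : ∀ i, i < 5 → G.Adj (w.getVert i) (w.getVert (i + 1)) := fun i hi =>
    w.adj_getVert_succ (by omega)
  have h5 : w.getVert 5 = w.getVert 0 := by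
    rw [← hl, w.getVert_length, w.getVert_zero]
  have h4 := hadj 4 (by omega)
  rw [h5] at h4
  obtain ⟨v, hv, -⟩ := pent_mk (hadj 0 (by omega)) (hadj 1 (by omega)) (hadj 2 (by omega))
    (hadj 3 (by omega)) h4
    (fun h => by have := hne _ _ (by omega) (by omega) h; omega)
    (fun h => by have := hne _ _ (by omega) (by omega) h; omega)
    (fun h => by have := hne _ _ (by omega) (by omega) h; omega)
    (fun h => by have := hne _ _ (by omega) (by omega) h; omega)
    (fun h => by have := hne _ _ (by omega) (by omega) h; omega)
  exact ⟨v, hv⟩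

end Pentagraph

/-- a 3-connected graph `G ∈ 𝒢₂` containing a 5-cycle, all of whose 3-cutsets
are stable, contains two distinct 5-cycles sharing at least one edge. -/
theorem stmt_9 {V : Type*} [Fintype V] (G : SimpleGraph V) (hG : G.MemGFamily 2)
    (h3c : G.ThreeConnected)
    (hc5 : ∃ (v : V) (w : G.Walk v v), w.IsCycle ∧ w.length = 5)
    (hstable : ∀ X : Set V, X.ncard = 3 → G.IsCutset X → ∀ a ∈ X, ∀ b ∈ X, ¬ G.Adj a b) :
    ∃ (v₁ v₂ : V) (w₁ : G.Walk v₁ v₁) (w₂ : G.Walk v₂ v₂),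
      w₁.IsCycle ∧ w₂.IsCycle ∧ w₁.length = 5 ∧ w₂.length = 5 ∧
      ¬ (∀ e, e ∈ w₁.edges ↔ e ∈ w₂.edges) ∧ ∃ e, e ∈ w₁.edges ∧ e ∈ w₂.edges := by
  by_contra hcon
  obtain ⟨a, w, hw, hl⟩ := hc5
  obtain ⟨v, hv⟩ := Pentagraph.pent_of_cycle w hw hl
  refine Pentagraph.finish (G := G) ⟨Pentagraph.no3 hG.1, Pentagraph.no4 hG.1,
    fun n h1 h2 => hG.2 n h1 (by omega), ?_⟩ h3c hstable hv
  intro p q hp hq h0 h1 i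
  by_contra hne
  push Not at hne
  apply hcon
  obtain ⟨a1, w1, c1, l1, e1⟩ := Pentagraph.pent_cycle hp
  obtain ⟨a2, w2, c2, l2, e2⟩ := Pentagraph.pent_cycle hq
  refine ⟨a1, a2, w1, w2, c1, c2, l1, l2, ?_, s(p 0, p 1), (e1 _).2 ⟨0, rfl⟩,
    (e2 _).2 ⟨0, by rw [h0, h1]; rfl⟩⟩
  intro hall
  obtain ⟨j, hj⟩ := (e1 _).1 ((hall _).2 ((e2 s(q i, q (i + 1))).2 ⟨i, rfl⟩))
  rw [Sym2.eq_iff] at hj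
  rcases hj with ⟨h, -⟩ | ⟨h, -⟩
  · exact hne _ h
  · exact hne _ h
end

section
/- Let G be a 3-connected graph in 𝒢₂, let C = u₀u₁u₂u₃u₄u₀ be a 5-cycle in G, and suppose that no two distinct 5-cycles of G share an edge. Then there exist an index i ∈ {0,1,2,3,4} (indices taken modulo 5) and a vertex w ∈ V(C) ∖ {u_i, u_{i+1}} such that {u_i, u_{i+1}, w} is a cutset of G. -/
open SimpleGraph

theorem last_before (P : ℕ → Prop) (a b : ℕ) (h : ∃ k, a ≤ k ∧ k < b ∧ P k) :
    ∃ k, a ≤ k ∧ k < b ∧ P k ∧ ∀ j, k < j → j < b → ¬ P j := by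
  induction b with
  | zero => obtain ⟨k, _, h, _⟩ := h; omega
  | succ b ih =>
    by_cases hb : a ≤ b ∧ P b
    · exact ⟨b, hb.1, by omega, hb.2, fun j _ _ => by omega⟩
    · obtain ⟨k, h1, h2, h3⟩ := h
      have hk : k ≠ b := by rintro rfl; exact hb ⟨h1, h3⟩
      obtain ⟨k, h1, h2, h3, h4⟩ := ih ⟨k, h1, by omega, h3⟩
      refine ⟨k, h1, by omega, h3, fun j hj hj2 hP => ?_⟩
      rcases Nat.lt_or_ge j b with h | h
      · exact h4 j hj h hP
      · have : j = b := by omega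
        subst this
        exact hb ⟨by omega, hP⟩

theorem first_after (P : ℕ → Prop) (a b : ℕ) (h : ∃ k, a < k ∧ k < b ∧ P k) :
    ∃ k, a < k ∧ k < b ∧ P k ∧ ∀ j, a < j → j < k → ¬ P j := by
  classical
  have h' : ∃ k, a < k ∧ P k := by obtain ⟨k, h1, _, h2⟩ := h; exact ⟨k, h1, h2⟩
  refine ⟨Nat.find h', (Nat.find_spec h').1, ?_, (Nat.find_spec h').2, fun j hj hj2 hP => 
    Nat.find_min h' hj2 ⟨hj, hP⟩⟩
  obtain ⟨k, h1, h2, h3⟩ := h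
  exact lt_of_le_of_lt (Nat.find_min' h' ⟨h1, h3⟩) h2

/-- the parity argument along a path -/
theorem comb (n : ℕ) (Lab : ℕ → Fin 5 → Prop)
    (huniq : ∀ k i j, k ≤ n → Lab k i → Lab k j → i = j)
    (hadj : ∀ k i j, k + 1 ≤ n → Lab k i → ¬ Lab (k + 1) j)
    (hg : ∀ (m : ℕ) (d i : Fin 5) (a b : ℕ), m ≤ 3 → (d = 1 ∨ d = 4) → a < b → b ≤ n →
      Lab a i → Lab b (i + Fin.ofNat 5 m * d) →
      (∀ k, a < k → k < b → ∀ t : ℕ, t ≤ m → ¬ Lab k (i + Fin.ofNat 5 t * d)) →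
      Even (b - a + m) ∨ (m = 0 ∧ b - a = 3))
    (hn : 0 < n) (h0 : Lab 0 0) (h2 : Lab n 2)
    (hmid : ∀ k, 0 < k → k < n → ¬ Lab k 0 ∧ ¬ Lab k 2) :
    (∀ k, k ≤ n → ¬ Lab k 3 ∧ ¬ Lab k 4) ∧ ∃ k, 0 < k ∧ k < n ∧ Lab k 1 := by
  have U : ∀ (d i : Fin 5) a b, (d = 1 ∨ d = 4) → a < b → b ≤ n → Lab a i → Lab b (i + 2 * d) →
      (∀ k, a < k → k < b → ∀ j, ¬ Lab k j) → False := by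
    intro d i a b hd hab hb ha hb' hk
    have e1 := hg 2 d i a b (by omega) hd hab hb ha (by exact hb')
      (fun k h1 h2 t _ => hk k h1 h2 _)
    have e2 := hg 3 (-d) i a b (by omega) (by rcases hd with rfl | rfl <;> decide) hab hb ha
      (by
        have : i + Fin.ofNat 5 3 * (-d) = i + 2 * d := by
          have hh : ∀ i d : Fin 5, i + Fin.ofNat 5 3 * (-d) = i + 2 * d := by decide
          exact hh i d
        rw [this]; exact hb')
      (fun k h1 h2 t _ => hk k h1 h2 _)
    simp at e1 e2
    rw [Nat.even_iff] at e1 e2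
    omega
  have five : ∀ k, ¬ Lab k 0 → ¬ Lab k 1 → ¬ Lab k 2 → ¬ Lab k 3 → ¬ Lab k 4 → ∀ j, ¬ Lab k j := by
    intro k a b c d e j
    fin_cases j <;> assumption
  have U' : ∀ (i j : Fin 5) a b, (j = i + 2 ∨ j = i + 3) → a < b → b ≤ n → Lab a i → Lab b j →
      (∀ k, a < k → k < b → ¬ Lab k 1 ∧ ¬ Lab k 3 ∧ ¬ Lab k 4) → False := by
    intro i j a b hij hab hb ha hb' hk
    have hk' : (∀ k, a < k → k < b → ∀ j, ¬ Lab k j) := fun k h1 h2 =>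
      five k (hmid k (by omega) (by omega)).1 (hk k h1 h2).1 (hmid k (by omega) (by omega)).2
        (hk k h1 h2).2.1 (hk k h1 h2).2.2
    rcases hij with rfl | rfl
    · exact U 1 i a b (Or.inl rfl) hab hb ha (by simpa using hb') hk'
    · exact U 4 i a b (Or.inr rfl) hab hb ha hb' hk'
  have S1 : ∀ x y, 0 < x → x < n → 0 < y → y < n → Lab x 1 → (Lab y 3 ∨ Lab y 4) → False := by
    intro x y hx hxn hy hyn lx ly
    have hne : x ≠ y := by
      rintro rfl
      rcases ly with ly | ly
      · exact absurd (huniq x _ _ hxn.le lx ly) (by decide)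
      · exact absurd (huniq x _ _ hxn.le lx ly) (by decide)
    rcases Nat.lt_or_gt_of_ne hne with h | h
    · obtain ⟨y', h1, h2, h3, h4⟩ := first_after (fun k => Lab k 3 ∨ Lab k 4) x n ⟨y, h, hyn, ly⟩
      obtain ⟨x', g1, g2, g3, g4⟩ := last_before (fun k => Lab k 1) x y' ⟨x, le_rfl, h1, lx⟩
      have hk : ∀ k, x' < k → k < y' → ¬ Lab k 1 ∧ ¬ Lab k 3 ∧ ¬ Lab k 4 := fun k e1 e2 =>
        ⟨g4 k e1 e2, not_or.1 (h4 k (by omega) e2)⟩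
      rcases h3 with h3 | h3
      · exact U' 1 3 x' y' (by decide) g2 h2.le g3 h3 hk
      · exact U' 1 4 x' y' (by decide) g2 h2.le g3 h3 hk
    · obtain ⟨x', h1, h2, h3, h4⟩ := first_after (fun k => Lab k 1) y n ⟨x, h, hxn, lx⟩
      obtain ⟨y', g1, g2, g3, g4⟩ :=
        last_before (fun k => Lab k 3 ∨ Lab k 4) y x' ⟨y, le_rfl, h1, ly⟩
      have hk : ∀ k, y' < k → k < x' → ¬ Lab k 1 ∧ ¬ Lab k 3 ∧ ¬ Lab k 4 := fun k e1 e2 =>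
        ⟨h4 k (by omega) e2, not_or.1 (g4 k e1 e2)⟩
      rcases g3 with h3' | h3'
      · exact U' 3 1 y' x' (by decide) g2 h2.le h3' h3 hk
      · exact U' 4 1 y' x' (by decide) g2 h2.le h3' h3 hk
  have S3 : (∀ k, 0 < k → k < n → ¬ Lab k 1) → False := by
    intro no1
    have no012 : ∀ k, 0 < k → k < n → ¬ Lab k 0 ∧ ¬ Lab k 1 ∧ ¬ Lab k 2 := fun k e1 e2 =>
      ⟨(hmid k e1 e2).1, no1 k e1 e2, (hmid k e1 e2).2⟩
    have hneven : Even n := by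
      have := hg 2 1 0 0 n (by omega) (Or.inl rfl) hn le_rfl h0 (by exact h2) (by
        intro k e1 e2 t ht
        obtain ⟨a, b, c⟩ := no012 k e1 e2
        interval_cases t <;> assumption)
      simp at this
      rw [Nat.even_iff] at this ⊢
      omega
    have T : ∀ x y, 0 < x → x < y → y < n → ((Lab x 3 ∧ Lab y 4) ∨ (Lab x 4 ∧ Lab y 3)) →
        (∀ k, x < k → k < y → ¬ Lab k 3 ∧ ¬ Lab k 4) → (y - x) % 2 = 1 := by
      intro x y hx hxy hy h hk
      rcases h with ⟨a, b⟩ | ⟨a, b⟩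
      · have := hg 1 1 3 x y (by omega) (Or.inl rfl) hxy hy.le a (by exact b) (by
          intro k e1 e2 t ht
          obtain ⟨c, d⟩ := hk k e1 e2
          interval_cases t <;> assumption)
        simp at this
        rw [Nat.even_iff] at this
        omega
      · have := hg 1 4 4 x y (by omega) (Or.inr rfl) hxy hy.le a (by exact b) (by
          intro k e1 e2 t ht
          obtain ⟨c, d⟩ := hk k e1 e2
          interval_cases t <;> assumption)
        simp at this
        rw [Nat.even_iff] at this
        omega
    have E : ∀ (i j : Fin 5) x y z, 0 < x → x < z → z < y → y < n → Lab x i → Lab y i → Lab z j →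
        (∀ k, x < k → k < y → ¬ Lab k i) → (y - x) % 2 = 0 := by
      intro i j x y z hx hxz hzy hy lx ly lz hk
      have hz : ∀ i : Fin 5, i + Fin.ofNat 5 0 * 1 = i := by decide
      rcases hg 0 1 i x y (by omega) (Or.inl rfl) (by omega) hy.le lx (by rw [hz i]; exact ly) (by
          intro k e1 e2 t ht
          obtain rfl : t = 0 := by omega
          rw [hz i]; exact hk k e1 e2) with h | ⟨_, h⟩
      · rw [Nat.even_iff] at h; omega
      · exfalso
        rcases (by omega : z = x + 1 ∨ y = z + 1) with rfl | rfl
        · exact hadj _ _ _ (by omega) lx lz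
        · exact hadj _ _ _ (by omega) lz ly
    have main : ∀ y, y < n → ∀ x, 0 < x → x < y → (∀ k, x < k → k < y → ¬ Lab k 3 ∧ ¬ Lab k 4) →
        (Lab x 4 → Lab y 3 → y % 2 = 1) ∧ (Lab x 3 → Lab y 4 → y % 2 = 0) := by
      intro y
      induction y using Nat.strong_induction_on with
      | _ y ih =>
      intro hy x hx hxy hk
      constructor
      · intro lx ly
        by_cases h3 : ∃ k, 1 ≤ k ∧ k < x ∧ Lab k 3
        · obtain ⟨z, z1, z2, z3, z4⟩ := last_before (fun k => Lab k 3) 1 x h3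
          obtain ⟨w, w1, w2, w3, w4⟩ := first_after (fun k => Lab k 4) z (x + 1)
            ⟨x, z2, by omega, lx⟩
          have hwz : ∀ k, z < k → k < w → ¬ Lab k 3 ∧ ¬ Lab k 4 := fun k e1 e2 =>
            ⟨z4 k e1 (by omega), w4 k e1 e2⟩
          have t1 := (ih w (by omega) (by omega) z (by omega) w1 hwz).2 z3 w3
          have t2 := T z w (by omega) w1 (by omega) (Or.inl ⟨z3, w3⟩) hwz
          have t3 := E 3 4 z y x (by omega) z2 hxy hy z3 ly lx (by
            intro k e1 e2
            rcases lt_trichotomy k x with h | h | h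
            · exact z4 k e1 h
            · subst h; intro h; exact absurd (huniq k _ _ (by omega) lx h) (by decide)
            · exact (hk k h e2).1)
          omega
        · push Not at h3
          have := hg 3 1 0 0 y (by omega) (Or.inl rfl) (by omega) hy.le h0 (by exact ly) (by
            intro k e1 e2 t ht
            obtain ⟨a, b, c⟩ := no012 k e1 (by omega)
            have d : ¬ Lab k 3 := by
              rcases lt_trichotomy k x with h | h | h
              · exact h3 k e1 h
              · subst h; intro h; exact absurd (huniq k _ _ (by omega) lx h) (by decide)
              · exact (hk k h e2).1
            interval_cases t <;> assumption)
          simp at this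
          rw [Nat.even_iff] at this
          omega
      · intro lx ly
        have h4 : ∃ k, 1 ≤ k ∧ k < x ∧ Lab k 4 := by
          by_contra hno
          push Not at hno
          obtain ⟨w, w1, w2, w3, w4⟩ := first_after (fun k => Lab k 3) 0 (x + 1)
            ⟨x, hx, by omega, lx⟩
          exact U' 0 3 0 w (by decide) w1 (by omega) h0 w3 (fun k e1 e2 =>
            ⟨no1 k e1 (by omega), w4 k e1 e2, hno k e1 (by omega)⟩)
        obtain ⟨z, z1, z2, z3, z4⟩ := last_before (fun k => Lab k 4) 1 x h4
        obtain ⟨w, w1, w2, w3, w4⟩ := first_after (fun k => Lab k 3) z (x + 1)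
          ⟨x, z2, by omega, lx⟩
        have hwz : ∀ k, z < k → k < w → ¬ Lab k 3 ∧ ¬ Lab k 4 := fun k e1 e2 =>
          ⟨w4 k e1 e2, z4 k e1 (by omega)⟩
        have t1 := (ih w (by omega) (by omega) z (by omega) w1 hwz).1 z3 w3
        have t2 := T z w (by omega) w1 (by omega) (Or.inr ⟨z3, w3⟩) hwz
        have t3 := E 4 3 z y x (by omega) z2 hxy hy z3 ly lx (by
          intro k e1 e2
          rcases lt_trichotomy k x with h | h | h
          · exact z4 k e1 h
          · subst h; intro h; exact absurd (huniq k _ _ (by omega) lx h) (by decide)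
          · exact (hk k h e2).2)
        omega
    have h4 : ∃ k, 1 ≤ k ∧ k < n ∧ Lab k 4 := by
      by_contra hno
      push Not at hno
      by_cases h3 : ∃ k, 0 < k ∧ k < n ∧ Lab k 3
      · obtain ⟨w, w1, w2, w3, w4⟩ := first_after (fun k => Lab k 3) 0 n h3
        exact U' 0 3 0 w (by decide) w1 (by omega) h0 w3 (fun k e1 e2 =>
            ⟨no1 k e1 (by omega), w4 k e1 e2, hno k e1 (by omega)⟩)
      · push Not at h3
        exact U' 0 2 0 n (by decide) hn le_rfl h0 h2 (fun k e1 e2 =>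
            ⟨no1 k e1 (by omega), h3 k e1 e2, hno k e1 (by omega)⟩)
    obtain ⟨s, s1, s2, s3, s4⟩ := last_before (fun k => Lab k 4) 1 n h4
    have h3 : ∃ k, s < k ∧ k < n ∧ Lab k 3 := by
      by_contra hno
      push Not at hno
      exact U' 4 2 s n (by decide) s2 le_rfl s3 h2 (fun k e1 e2 =>
            ⟨no1 k (by omega) (by omega), hno k e1 e2, s4 k e1 (by omega)⟩)
    obtain ⟨t, t1, t2, t3, t4⟩ := first_after (fun k => Lab k 3) s n h3
    have hst : ∀ k, s < k → k < t → ¬ Lab k 3 ∧ ¬ Lab k 4 := fun k e1 e2 =>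
      ⟨t4 k e1 e2, s4 k e1 (by omega)⟩
    have r1 := (main t t2 s s1 t1 hst).1 s3 t3
    have r2 := T s t s1 t1 t2 (Or.inr ⟨s3, t3⟩) hst
    have r3 := hg 3 1 4 s n (by omega) (Or.inl rfl) s2 le_rfl s3 (by exact h2) (by
      intro k e1 e2 t ht
      obtain ⟨a, b, c⟩ := no012 k (by omega) e2
      have := s4 k e1 e2
      interval_cases t <;> assumption)
    simp at r3
    rw [Nat.even_iff] at r3 hneven
    omega
  obtain ⟨x, hx1, hx2, hx3⟩ : ∃ k, 0 < k ∧ k < n ∧ Lab k 1 := by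
    by_contra h
    push Not at h
    exact S3 h
  refine ⟨fun k hk => ?_, x, hx1, hx2, hx3⟩
  rcases Nat.eq_zero_or_pos k with rfl | hk0
  · exact ⟨fun h => absurd (huniq 0 _ _ hk h0 h) (by decide),
      fun h => absurd (huniq 0 _ _ hk h0 h) (by decide)⟩
  rcases hk.lt_or_eq with hkn | rfl
  · exact ⟨fun h => S1 x k hx1 hx2 hk0 hkn hx3 (Or.inl h),
      fun h => S1 x k hx1 hx2 hk0 hkn hx3 (Or.inr h)⟩
  · exact ⟨fun h => absurd (huniq k _ _ hk h2 h) (by decide),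
      fun h => absurd (huniq k _ _ hk h2 h) (by decide)⟩

/-- the walk along a sequence of adjacent vertices -/
theorem path_walk {V : Type*} (G : SimpleGraph V) (f : ℕ → V) (M : ℕ)
    (hinj : ∀ i j, i ≤ M → j ≤ M → f i = f j → i = j)
    (hadj : ∀ k, k < M → G.Adj (f k) (f (k + 1))) :
    ∃ w : G.Walk (f 0) (f M), w.IsPath ∧ w.length = M ∧
      (∀ v, v ∈ w.support ↔ ∃ k, k ≤ M ∧ f k = v) ∧
      (∀ e, e ∈ w.edges ↔ ∃ k, k < M ∧ e = s(f k, f (k + 1))) := by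
  induction M with
  | zero => 
    refine ⟨Walk.nil, by simp, rfl, fun v => ?_, by simp⟩
    simp [eq_comm]
  | succ M ih =>
    obtain ⟨w, h1, h2, h3, h4⟩ := ih (fun i j hi hj => hinj i j (by omega) (by omega))
      (fun k hk => hadj k (by omega))
    refine ⟨w.concat (hadj M (by omega)), ?_, by simp [h2], fun v => ?_, fun e => ?_⟩
    · refine h1.concat ?_ _
      rw [h3]
      rintro ⟨k, hk, e⟩
      have := hinj k (M + 1) (by omega) le_rfl e
      omega
    · rw [Walk.support_concat]
      simp only [List.mem_append, h3, List.mem_singleton]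
      constructor
      · rintro (⟨k, hk, e⟩ | rfl)
        · exact ⟨k, by omega, e⟩
        · exact ⟨M + 1, le_rfl, rfl⟩
      · rintro ⟨k, hk, e⟩
        rcases hk.lt_or_eq with h | rfl
        · exact Or.inl ⟨k, by omega, e⟩
        · exact Or.inr e.symm
    · rw [Walk.edges_concat]
      simp only [List.concat_eq_append, List.mem_append, h4, List.mem_singleton]
      constructor
      · rintro (⟨k, hk, e⟩ | rfl)
        · exact ⟨k, by omega, e⟩
        · exact ⟨M, by omega, rfl⟩
      · rintro ⟨k, hk, e⟩
        rcases (Nat.lt_succ_iff.1 hk).lt_or_eq with h | rfl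
        · exact Or.inl ⟨k, by omega, e⟩
        · exact Or.inr e

/-- the cycle along a sequence -/
theorem cyc_walk {V : Type*} (G : SimpleGraph V) (f : ℕ → V) (M : ℕ) (hM : 2 ≤ M)
    (hinj : ∀ i j, i ≤ M → j ≤ M → f i = f j → i = j)
    (hadj : ∀ k, k < M → G.Adj (f k) (f (k + 1))) (hclose : G.Adj (f M) (f 0)) :
    ∃ w : G.Walk (f M) (f M), w.IsCycle ∧ w.length = M + 1 ∧
      (∀ v, v ∈ w.support ↔ ∃ k, k ≤ M ∧ f k = v) ∧
      (∀ e, e ∈ w.edges ↔ e = s(f M, f 0) ∨ ∃ k, k < M ∧ e = s(f k, f (k + 1))) := by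
  obtain ⟨w, h1, h2, h3, h4⟩ := path_walk G f M hinj hadj
  refine ⟨Walk.cons hclose w, ?_, by simp [h2], fun v => ?_, fun e => ?_⟩
  · rw [Walk.cons_isCycle_iff]
    refine ⟨h1, ?_⟩
    rw [h4]
    rintro ⟨k, hk, e⟩
    rw [Sym2.eq_iff] at e
    rcases e with ⟨e1, e2⟩ | ⟨e1, e2⟩
    · have := hinj _ _ le_rfl (by omega) e1
      omega
    · have := hinj _ _ le_rfl (by omega) e1
      have := hinj _ _ (by omega) (by omega) e2
      omega
  · rw [Walk.support_cons, List.mem_cons, h3]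
    constructor
    · rintro (rfl | h)
      · exact ⟨M, le_rfl, rfl⟩
      · exact h
    · exact Or.inr
  · rw [Walk.edges_cons, List.mem_cons, h4]

theorem hole_of {V : Type*} (G : SimpleGraph V) (f : ℕ → V) (M : ℕ) (hM : 3 ≤ M)
    (hinj : ∀ i j, i ≤ M → j ≤ M → f i = f j → i = j)
    (hadj : ∀ k, k < M → G.Adj (f k) (f (k + 1))) (hclose : G.Adj (f M) (f 0))
    (hind : ∀ i j, i < j → j ≤ M → G.Adj (f i) (f j) → j = i + 1 ∨ (i = 0 ∧ j = M)) :
    G.HasHole (M + 1) := by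
  obtain ⟨w, h1, h2, h3, h4⟩ := cyc_walk G f M (by omega) hinj hadj hclose
  refine ⟨by omega, _, w, h1, ?_, h2⟩
  have key : ∀ i j, i < j → j ≤ M → G.Adj (f i) (f j) → s(f i, f j) ∈ w.edges := by
    intro i j hij hj ha
    rw [h4]
    rcases hind i j hij hj ha with rfl | ⟨rfl, rfl⟩
    · exact Or.inr ⟨i, by omega, rfl⟩
    · exact Or.inl Sym2.eq_swap
  intro x hx y hy hxy
  rw [Walk.mem_verts_toSubgraph, h3] at hx hy
  obtain ⟨i, hi, rfl⟩ := hx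
  obtain ⟨j, hj, rfl⟩ := hy
  rw [Walk.adj_toSubgraph_iff_mem_edges]
  rcases lt_trichotomy i j with h | rfl | h
  · exact key i j h hj hxy
  · exact absurd hxy (G.loopless.irrefl _)
  · rw [Sym2.eq_swap]; exact key j i h hi hxy.symm

theorem shortest {V : Type*} (G : SimpleGraph V) (a b : V) (h : G.Reachable a b) :
    ∃ (m : ℕ) (p : ℕ → V), p 0 = a ∧ p m = b ∧ (∀ k, k < m → G.Adj (p k) (p (k + 1))) ∧
      (∀ i j, i < j → j ≤ m → p i ≠ p j) ∧
      (∀ i j, i < j → j ≤ m → G.Adj (p i) (p j) → j = i + 1) := by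
  obtain ⟨w, hw⟩ := h.exists_walk_length_eq_dist
  refine ⟨w.length, w.getVert, by simp, by simp, fun k hk => w.adj_getVert_succ hk, ?_, ?_⟩
  · intro i j hij hj e
    have := G.dist_le ((w.take i).append ((w.drop j).copy e.symm rfl))
    simp [Walk.take_length, Walk.drop_length] at this
    omega
  · intro i j hij hj e
    have := G.dist_le ((w.take i).append (Walk.cons e (w.drop j)))
    simp [Walk.take_length, Walk.drop_length] at this
    omega

/-- the standing hypotheses on the pentagon `u` in `G` -/
structure Setup {V : Type*} (G : SimpleGraph V) (u : Fin 5 → V) : Prop where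
  inj : Function.Injective u
  adj : ∀ i : Fin 5, G.Adj (u i) (u (i + 1))
  cyc : ∀ (v : V) (w : G.Walk v v), w.IsCycle → 5 ≤ w.length
  hole : ∀ n : ℕ, Odd n → 7 ≤ n → ¬ G.HasHole n
  share : ∀ (v₁ v₂ : V) (w₁ : G.Walk v₁ v₁) (w₂ : G.Walk v₂ v₂),
      w₁.IsCycle → w₂.IsCycle → w₁.length = 5 → w₂.length = 5 →
      (∃ e, e ∈ w₁.edges ∧ e ∈ w₂.edges) → (∀ e, e ∈ w₁.edges ↔ e ∈ w₂.edges)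

namespace Setup

variable {V : Type*} {G : SimpleGraph V} {u : Fin 5 → V}

theorem shift (S : Setup G u) (c : Fin 5) : Setup G (fun j => u (j + c)) where
  inj := fun a b h => by simpa using S.inj h
  adj := fun i => by
    have := S.adj (i + c)
    rw [add_right_comm] at this
    exact this
  cyc := S.cyc
  hole := S.hole
  share := S.share

theorem no3 (S : Setup G u) {a b c : V} (h1 : G.Adj a b) (h2 : G.Adj b c) (h3 : G.Adj c a) :
    False := by
  obtain ⟨w, w1, w2, -⟩ := cyc_walk G (fun k => if k = 0 then a else if k = 1 then b else c) 2
    le_rfl (by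
      intro i j hi hj
      have := h1.ne; have := h2.ne; have := h3.ne
      interval_cases i <;> interval_cases j <;> simp <;> grind) (by
      intro k hk
      interval_cases k <;> simpa) (by simpa)
  have := S.cyc _ w w1
  omega

theorem no4 (S : Setup G u) {a b c d : V} (h1 : G.Adj a b) (h2 : G.Adj b c) (h3 : G.Adj c d)
    (h4 : G.Adj d a) (hac : a ≠ c) (hbd : b ≠ d) : False := by
  obtain ⟨w, w1, w2, -⟩ := cyc_walk G
    (fun k => if k = 0 then a else if k = 1 then b else if k = 2 then c else d) 3
    (by omega) (by
      intro i j hi hj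
      have := h1.ne; have := h2.ne; have := h3.ne; have := h4.ne
      interval_cases i <;> interval_cases j <;> simp <;> grind) (by
      intro k hk
      interval_cases k <;> simpa) (by simpa)
  have := S.cyc _ w w1
  omega

theorem diff : ∀ i j : Fin 5, j = i ∨ j = i + 1 ∨ i = j + 1 ∨ j = i + 2 ∨ i = j + 2 := by decide

theorem adj2 (S : Setup G u) (i : Fin 5) : G.Adj (u (i + 1)) (u (i + 2)) := by
  have h := S.adj (i + 1)
  have e : i + 1 + 1 = i + 2 := (by decide : ∀ i : Fin 5, i + 1 + 1 = i + 2) i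
  rwa [e] at h

theorem chord (S : Setup G u) (i j : Fin 5) (h : G.Adj (u i) (u j)) : j = i + 1 ∨ i = j + 1 := by
  rcases diff i j with rfl | h' | h' | rfl | rfl
  · exact absurd h (G.loopless.irrefl _)
  · exact Or.inl h'
  · exact Or.inr h'
  · exact (S.no3 (S.adj i) (S.adj2 i) h.symm).elim
  · exact (S.no3 (S.adj j) (S.adj2 j) h).elim

theorem ne_of_off {x : V} (hx : x ∉ Set.range u) (i : Fin 5) : u i ≠ x := fun h => hx ⟨i, h⟩

theorem ne2 (S : Setup G u) (i : Fin 5) : u i ≠ u (i + 2) := by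
  intro h
  exact (by decide : ∀ i : Fin 5, i ≠ i + 2) i (S.inj h)

/-- uniqueness of attachments -/
theorem uniq (S : Setup G u) {x : V} (hx : x ∉ Set.range u) {i j : Fin 5}
    (hi : G.Adj x (u i)) (hj : G.Adj x (u j)) : i = j := by
  rcases diff i j with h | rfl | rfl | rfl | rfl
  · exact h.symm
  · exact (S.no3 hi (S.adj i) hj.symm).elim
  · exact (S.no3 hj (S.adj j) hi.symm).elim
  · exact (S.no4 hi (S.adj i) (S.adj2 i) hj.symm (ne_of_off hx _).symm (S.ne2 i)).elim
  · exact (S.no4 hj (S.adj j) (S.adj2 j) hi.symm (ne_of_off hx _).symm (S.ne2 j)).elim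

/-- no other 5-cycle shares an edge with the pentagon -/
theorem share5 (S : Setup G u) (f : ℕ → V)
    (hinj : ∀ i j, i ≤ 4 → j ≤ 4 → f i = f j → i = j)
    (hadj : ∀ k, k < 4 → G.Adj (f k) (f (k + 1))) (hclose : G.Adj (f 4) (f 0))
    (h0 : f 0 ∉ Set.range u)
    (he : ∃ i k, k < 4 ∧ s(f k, f (k + 1)) = s(u i, u (i + 1))) : False := by
  obtain ⟨w, w1, w2, w3, w4⟩ := cyc_walk G f 4 (by omega) hinj hadj hclose
  obtain ⟨c, c1, c2, c3, c4⟩ := cyc_walk G (fun k => u (Fin.ofNat 5 k)) 4 (by omega) (by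
      intro i j hi hj h
      have h := S.inj h
      interval_cases i <;> interval_cases j <;> first | rfl | (revert h; decide)) (by
      intro k hk
      have := S.adj (Fin.ofNat 5 k)
      interval_cases k <;> exact this) (S.adj 4)
  obtain ⟨i, k, hk, e⟩ := he
  have := (S.share _ _ w c w1 c1 w2 c2 ⟨s(u i, u (i + 1)), (w4 _).2 (Or.inr ⟨k, hk, e.symm⟩), by
    rw [c4]
    fin_cases i
    · exact Or.inr ⟨0, by omega, rfl⟩
    · exact Or.inr ⟨1, by omega, rfl⟩
    · exact Or.inr ⟨2, by omega, rfl⟩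
    · exact Or.inr ⟨3, by omega, rfl⟩
    · exact Or.inl rfl⟩ s(f 4, f 0)).1 ((w4 _).2 (Or.inl rfl))
  rw [c4] at this
  rcases this with h | ⟨k, _, h⟩
  · rw [Sym2.eq_iff] at h
    rcases h with ⟨_, h⟩ | ⟨_, h⟩ <;> exact h0 ⟨_, h.symm⟩
  · rw [Sym2.eq_iff] at h
    rcases h with ⟨_, h⟩ | ⟨_, h⟩ <;> exact h0 ⟨_, h.symm⟩

theorem lab_adj2 (S : Setup G u) {x y : V} (hx : x ∉ Set.range u) (hy : y ∉ Set.range u)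
    (hxy : G.Adj x y) {i : Fin 5} (hi : G.Adj x (u i)) (hj : G.Adj y (u (i + 2))) : False := by
  have a1 := S.adj i
  have a2 := S.adj2 i
  refine S.share5 (fun k => if k = 0 then x else if k = 1 then y else if k = 2 then u (i + 2) else
    if k = 3 then u (i + 1) else u i) ?_ ?_ ?_ (by simpa using hx) ⟨i, 3, by omega, ?_⟩
  · intro s t hs ht
    have := hxy.ne; have := S.ne2 i; have := a1.ne; have := a2.ne
    have := fun i => ne_of_off hx i
    have := fun i => ne_of_off hy i
    interval_cases s <;> interval_cases t <;> simp <;> grind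
  · intro k hk
    interval_cases k
    · simpa using hxy
    · simpa using hj
    · simpa using a2.symm
    · simpa using a1.symm
  · simpa using hi.symm
  · simp [Sym2.eq_swap]

/-- adjacent vertices off the pentagon are not both attached -/
theorem lab_adj (S : Setup G u) {x y : V} (hx : x ∉ Set.range u) (hy : y ∉ Set.range u)
    (hxy : G.Adj x y) {i j : Fin 5} (hi : G.Adj x (u i)) (hj : G.Adj y (u j)) : False := by
  rcases diff i j with rfl | rfl | rfl | rfl | rfl
  · exact S.no3 hxy hj hi.symm
  · exact S.no4 hxy hj (S.adj i).symm hi.symm (ne_of_off hx _).symm (ne_of_off hy _).symm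
  · exact S.no4 hxy hj (S.adj j) hi.symm (ne_of_off hx _).symm (ne_of_off hy _).symm
  · exact S.lab_adj2 hx hy hxy hi hj
  · exact S.lab_adj2 hy hx hxy.symm hj hi

theorem idx_inj : ∀ (d i : Fin 5) (r s : Fin 4), (d = 1 ∨ d = 4) →
    i + Fin.ofNat 5 r * d = i + Fin.ofNat 5 s * d → r = s := by decide

theorem idx_succ : ∀ (d i : Fin 5) (r s : Fin 4), (d = 1 ∨ d = 4) →
    (i + Fin.ofNat 5 r * d = i + Fin.ofNat 5 s * d + 1 ∨
     i + Fin.ofNat 5 s * d = i + Fin.ofNat 5 r * d + 1) → 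
     (r.val = s.val + 1 ∨ s.val = r.val + 1) := by decide

theorem idx_next : ∀ (d i : Fin 5) (r : Fin 4), (d = 1 ∨ d = 4) →
    (i + Fin.ofNat 5 (r.val + 1) * d = i + Fin.ofNat 5 r * d + 1 ∨
     i + Fin.ofNat 5 r * d = i + Fin.ofNat 5 (r.val + 1) * d + 1) := by decide

theorem glue (S : Setup G u) (n : ℕ) (p : ℕ → V) (hoff : ∀ k, k ≤ n → p k ∉ Set.range u)
    (padj : ∀ k, k < n → G.Adj (p k) (p (k + 1)))
    (pinj : ∀ i j, i < j → j ≤ n → p i ≠ p j)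
    (pind : ∀ i j, i < j → j ≤ n → G.Adj (p i) (p j) → j = i + 1)
    (m : ℕ) (d i : Fin 5) (a b : ℕ) (hm : m ≤ 3) (hd : d = 1 ∨ d = 4) (hab : a < b) (hb : b ≤ n)
    (ha : G.Adj (p a) (u i)) (hb' : G.Adj (p b) (u (i + Fin.ofNat 5 m * d)))
    (hmid : ∀ k, a < k → k < b → ∀ t : ℕ, t ≤ m → ¬ G.Adj (p k) (u (i + Fin.ofNat 5 t * d))) :
    Even (b - a + m) ∨ (m = 0 ∧ b - a = 3) := by
  obtain ⟨l, rfl⟩ : ∃ l, b = a + l := ⟨b - a, by omega⟩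
  have hl : 1 ≤ l := by omega
  simp only [Nat.add_sub_cancel_left]
  have z : ∀ i d : Fin 5, i + Fin.ofNat 5 0 * d = i := by decide
  obtain ⟨q, hq⟩ : ∃ q : ℕ → V, ∀ r, q r = u (i + Fin.ofNat 5 r * d) := ⟨_, fun r => rfl⟩
  have q0 : q 0 = u i := by rw [hq, z]
  have qinj : ∀ r s, r ≤ 3 → s ≤ 3 → q r = q s → r = s := by
    intro r s hr hs h
    rw [hq, hq] at h
    exact congrArg Fin.val (idx_inj d i ⟨r, by omega⟩ ⟨s, by omega⟩ hd (S.inj h))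
  have qind : ∀ r s, r ≤ 3 → s ≤ 3 → G.Adj (q r) (q s) → (r = s + 1 ∨ s = r + 1) := by
    intro r s hr hs h
    rw [hq, hq] at h
    exact idx_succ d i ⟨r, by omega⟩ ⟨s, by omega⟩ hd (S.chord _ _ h).symm
  have qedge : ∀ r, r ≤ 3 → ∃ j, s(q (r + 1), q r) = s(u j, u (j + 1)) := by
    intro r hr
    rcases idx_next d i ⟨r, by omega⟩ hd with h | h
    · refine ⟨i + Fin.ofNat 5 r * d, ?_⟩
      simp only at h
      rw [hq, hq, h, Sym2.eq_swap]
    · refine ⟨i + Fin.ofNat 5 (r + 1) * d, ?_⟩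
      simp only at h
      rw [hq, hq, h]
  have qadj : ∀ r, r ≤ 3 → G.Adj (q (r + 1)) (q r) := by
    intro r hr
    obtain ⟨j, hj⟩ := qedge r hr
    have := S.adj j
    rw [← SimpleGraph.mem_edgeSet, ← hj] at this
    exact this
  have qoff : ∀ k r, k ≤ n → p k ≠ q r := by
    intro k r hk h
    exact hoff k hk ⟨_, by rw [h, hq]⟩
  have pq : ∀ k r, a ≤ k → k ≤ a + l → r ≤ m → G.Adj (p k) (q r) →
      (k = a ∧ r = 0) ∨ (k = a + l ∧ r = m) := by
    intro k r h1 h2 hr h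
    rcases h1.eq_or_lt with rfl | h1
    · left
      refine ⟨rfl, qinj _ _ (by omega) (by omega) ?_⟩
      rw [hq] at h
      rw [q0, hq, S.uniq (hoff a (by omega)) h ha]
    rcases h2.eq_or_lt with rfl | h2
    · right
      refine ⟨rfl, qinj _ _ (by omega) (by omega) ?_⟩
      rw [hq] at h
      rw [hq, hq, S.uniq (hoff _ hb) h hb']
    · rw [hq] at h
      exact (hmid k h1 h2 r hr h).elim
  rw [← q0] at ha
  rw [← hq] at hb'
  obtain ⟨f, f1, f2⟩ : ∃ f : ℕ → V, (∀ k, k ≤ l → f k = p (a + k)) ∧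
      (∀ k, l < k → f k = q (l + 1 + m - k)) :=
    ⟨fun k => if k ≤ l then p (a + k) else q (l + 1 + m - k), fun k hk => by simp [hk],
      fun k hk => by simp [hk]⟩
  have finj' : ∀ i j, i < j → j ≤ l + 1 + m → f i ≠ f j := by
    intro i j hij hj h
    rcases Nat.lt_or_ge l i with hi | hi
    · rw [f2 i hi, f2 j (by omega)] at h
      have := qinj _ _ (by omega) (by omega) h
      omega
    · rw [f1 i hi] at h
      rcases Nat.lt_or_ge l j with hj' | hj'
      · rw [f2 j hj'] at h
        exact qoff _ _ (by omega) h
      · rw [f1 j hj'] at h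
        exact pinj _ _ (by omega) (by omega) h
  have finj : ∀ i j, i ≤ l + 1 + m → j ≤ l + 1 + m → f i = f j → i = j := by
    intro i j hi hj h
    rcases lt_trichotomy i j with h' | h' | h'
    · exact (finj' _ _ h' hj h).elim
    · exact h'
    · exact (finj' _ _ h' hi h.symm).elim
  have fadj : ∀ k, k < l + 1 + m → G.Adj (f k) (f (k + 1)) := by
    intro k hk
    rcases lt_trichotomy k l with h | rfl | h
    · rw [f1 k h.le, f1 (k + 1) h]
      exact padj _ (by omega)
    · rw [f1 k le_rfl, f2 (k + 1) (by omega)]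
      rwa [Nat.add_sub_cancel_left]
    · rw [f2 k h, f2 (k + 1) (by omega)]
      have := qadj (l + 1 + m - (k + 1)) (by omega)
      rwa [show l + 1 + m - (k + 1) + 1 = l + 1 + m - k by omega] at this
  have fclose : G.Adj (f (l + 1 + m)) (f 0) := by
    rw [f2 _ (by omega), f1 0 (by omega), Nat.sub_self]
    exact ha.symm
  have find : ∀ i j, i < j → j ≤ l + 1 + m → G.Adj (f i) (f j) →
      j = i + 1 ∨ (i = 0 ∧ j = l + 1 + m) := by
    intro i j hij hj h
    rcases Nat.lt_or_ge l i with hi | hi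
    · rw [f2 i hi, f2 j (by omega)] at h
      have := qind _ _ (by omega) (by omega) h
      omega
    · rw [f1 i hi] at h
      rcases Nat.lt_or_ge l j with hj' | hj'
      · rw [f2 j hj'] at h
        have := pq _ _ (by omega) (by omega) (by omega) h
        omega
      · rw [f1 j hj'] at h
        have := pind _ _ (by omega) (by omega) h
        omega
  by_contra hcon
  push Not at hcon
  obtain ⟨ho, h3⟩ := hcon
  rw [Nat.not_even_iff_odd] at ho
  rcases Nat.lt_or_ge (l + m) 5 with h5 | h5
  · obtain ⟨w, w1, w2, -⟩ := cyc_walk G f (l + 1 + m) (by omega) finj fadj fclose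
    have := S.cyc _ _ w1
    have ho' := Nat.odd_iff.1 ho
    have hM : l + 1 + m = 4 := by omega
    have hm1 : 1 ≤ m := by
      by_contra hm1
      exact h3 (by omega) (by omega)
    rw [hM] at finj fclose fadj
    refine S.share5 f finj fadj fclose ?_ ?_
    · rw [f1 0 (by omega)]; exact hoff _ (by omega)
    · obtain ⟨j, hj⟩ := qedge (m - 1) (by omega)
      refine ⟨j, l + 1, by omega, ?_⟩
      rw [← hj, f2 _ (by omega), f2 _ (by omega)]
      rw [show l + 1 + m - (l + 1) = m - 1 + 1 by omega,
        show l + 1 + m - (l + 1 + 1) = m - 1 by omega]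
  · refine S.hole (l + 1 + m + 1) ?_ (by omega)
      (hole_of G f (l + 1 + m) (by omega) finj fadj fclose find)
    rw [Nat.odd_iff] at ho ⊢
    omega

end Setup

theorem jump {V : Type*} {G : SimpleGraph V} {u : Fin 5 → V} (S : Setup G u) (T : Set V)
    (h0 : u 0 ∈ T) (h2 : u 2 ∈ T) (h1 : u 1 ∉ T) (h3 : u 3 ∉ T) (h4 : u 4 ∉ T)
    (hr : (G.induce T).Reachable ⟨u 0, h0⟩ ⟨u 2, h2⟩) :
    ∃ (n : ℕ) (p : ℕ → V), (∀ k, k ≤ n → p k ∈ T ∧ p k ∉ Set.range u) ∧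
      (∀ k, k < n → G.Adj (p k) (p (k + 1))) ∧ G.Adj (p 0) (u 0) ∧ G.Adj (p n) (u 2) ∧
      (∀ k, k ≤ n → ¬ G.Adj (p k) (u 3) ∧ ¬ G.Adj (p k) (u 4)) ∧
      ∃ k, k ≤ n ∧ G.Adj (p k) (u 1) := by
  obtain ⟨m, P, P0, Pm, Padj, Pinj, Pind⟩ := shortest _ _ _ hr
  have Q0 : (P 0 : V) = u 0 := by rw [P0]
  have Qm : (P m : V) = u 2 := by rw [Pm]
  have Qadj : ∀ k, k < m → G.Adj (P k : V) (P (k + 1)) := fun k hk => Padj k hk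
  have Qinj : ∀ i j, i < j → j ≤ m → (P i : V) ≠ P j := fun i j hi hj h =>
    Pinj i j hi hj (Subtype.ext h)
  have Qind : ∀ i j, i < j → j ≤ m → G.Adj (P i : V) (P j) → j = i + 1 := fun i j hi hj h =>
    Pind i j hi hj h
  have off : ∀ k, 0 < k → k < m → (P k : V) ∉ Set.range u := by
    rintro k hk hkm ⟨j, hj⟩
    have hT : u j ∈ T := by rw [hj]; exact (P k).2
    fin_cases j
    · exact Qinj 0 k hk hkm.le (Q0.trans hj)
    · exact h1 hT
    · exact Qinj k m hkm le_rfl (hj.symm.trans Qm.symm)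
    · exact h3 hT
    · exact h4 hT
  have m0 : m ≠ 0 := by
    rintro rfl
    exact absurd (S.inj (Q0.symm.trans Qm)) (by decide)
  have m1 : m ≠ 1 := by
    rintro rfl
    have := Qadj 0 (by omega)
    rw [Q0, Qm] at this
    exact absurd (S.chord _ _ this) (by decide)
  have m2 : m ≠ 2 := by
    rintro rfl
    have a1 := Qadj 0 (by omega)
    have a2 := Qadj 1 (by omega)
    rw [Q0] at a1
    rw [Qm] at a2
    exact absurd (S.uniq (off 1 (by omega) (by omega)) a1.symm a2) (by decide)
  obtain ⟨n, rfl⟩ : ∃ n, m = n + 2 := ⟨m - 2, by omega⟩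
  have e0 : G.Adj (P 1 : V) (u 0) := by
    have := Qadj 0 (by omega)
    rw [Q0] at this
    exact this.symm
  have en : G.Adj (P (n + 1) : V) (u 2) := by
    have := Qadj (n + 1) (by omega)
    rwa [Qm] at this
  have off' : ∀ k, k ≤ n → (P (k + 1) : V) ∉ Set.range u := fun k hk =>
    off (k + 1) (by omega) (by omega)
  have padj : ∀ k, k < n → G.Adj (P (k + 1) : V) (P (k + 1 + 1)) := fun k hk =>
    Qadj (k + 1) (by omega)
  have key := comb n (fun k i => G.Adj (P (k + 1) : V) (u i))
    (fun k i j hk a b => S.uniq (off' k hk) a b)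
    (fun k i j hk a b => S.lab_adj (off' k (by omega)) (off' (k + 1) hk) (padj k hk) a b)
    (S.glue n (fun k => (P (k + 1) : V)) off' padj
      (fun i j hi hj => Qinj _ _ (by omega) (by omega))
      (fun i j hi hj h => by have := Qind _ _ (by omega) (by omega) h; omega))
    (by omega) e0 en (fun k hk hkn => ⟨fun h => ?_, fun h => ?_⟩)
  · obtain ⟨k1, k, hk, hkn, hl⟩ := key
    exact ⟨n, fun k => (P (k + 1) : V), fun k hk => ⟨(P (k + 1)).2, off' k hk⟩, padj, e0, en, k1,
      k, hkn.le, hl⟩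
  · have := Qind 0 (k + 1) (by omega) (by omega) (by rw [Q0]; exact h.symm)
    omega
  · have := Qind (k + 1) (n + 2) (by omega) (by omega) (by rw [Qm]; exact h)
    omega

theorem reach_closed {V : Type*} (G : SimpleGraph V) (R : Set V) (a b : V)
    (h : G.Reachable a b) (ha : a ∈ R) (hR : ∀ x y, x ∈ R → G.Adj x y → y ∈ R) : b ∈ R := by
  obtain ⟨w⟩ := h
  induction w with
  | nil => exact ha
  | cons e w ih => exact ih (hR _ _ ha e)

/-- let `G ∈ 𝒢₂` be 3-connected, let `u₀u₁u₂u₃u₄u₀` be a 5-cycle in `G`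
(given by an injective `u : Fin 5 → V` with consecutive vertices adjacent), and suppose
no two distinct 5-cycles of `G` share an edge.  Then for some `i` and some vertex `w` of
the cycle other than `u i, u (i+1)`, the set `{u i, u (i+1), w}` is a cutset of `G`. -/
theorem stmt_13 {V : Type*} [Fintype V] (G : SimpleGraph V) (hG : G.MemGFamily 2)
    (h3c : G.ThreeConnected) (u : Fin 5 → V) (hinj : Function.Injective u)
    (hadj : ∀ i : Fin 5, G.Adj (u i) (u (i + 1)))
    (h5 : ∀ (v₁ v₂ : V) (w₁ : G.Walk v₁ v₁) (w₂ : G.Walk v₂ v₂),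
      w₁.IsCycle → w₂.IsCycle → w₁.length = 5 → w₂.length = 5 →
      (∃ e, e ∈ w₁.edges ∧ e ∈ w₂.edges) → (∀ e, e ∈ w₁.edges ↔ e ∈ w₂.edges)) :
    ∃ (i : Fin 5) (w : V), w ∈ Set.range u \ {u i, u (i + 1)} ∧
      G.IsCutset {u i, u (i + 1), w} := by
  classical
  have S : Setup G u := ⟨hinj, hadj, fun v w hw => by
    have h1 := hw
    have h := hG.1
    have : G.egirth ≤ w.length := egirth_le_length hw
    rw [h] at this
    exact_mod_cast this, fun n hn h7 => hG.2 n hn h7, h5⟩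
  have hne : ∀ i j : Fin 5, i ≠ j → u i ≠ u j := fun i j h e => h (hinj e)
  by_contra hno
  have conn : ∀ (i j : Fin 5), j ≠ i → j ≠ i + 1 →
      (G.induce (({u i, u (i + 1), u j} : Set V)ᶜ)).Connected := by
    intro i j h1 h2
    by_contra hc
    exact hno ⟨i, u j, ⟨⟨j, rfl⟩, by simp [hinj.eq_iff, h1, h2]⟩, hc⟩
  have c1 := conn 3 1 (by decide) (by decide)
  have c2 := conn 0 2 (by decide) (by decide)
  obtain ⟨n, p, hp, padj, p0, pn, p34, -⟩ := jump S _ (by simp [hinj.eq_iff]) (by simp [hinj.eq_iff])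
    (by simp) (by simp) (by simp) (c1.preconnected ⟨u 0, by simp [hinj.eq_iff]⟩
      ⟨u 2, by simp [hinj.eq_iff]⟩)
  let T : Set V := {v | v ∉ Set.range u ∧ ¬ G.Adj v (u 3) ∧ ¬ G.Adj v (u 4)}
  let R : Set V := {v | Relation.ReflTransGen (fun a b => G.Adj a b ∧ b ∈ T) (p 0) v}
  have pT : ∀ k, k ≤ n → p k ∈ T := fun k hk => ⟨(hp k hk).2, p34 k hk⟩
  have RT : ∀ v, v ∈ R → v ∈ T := by
    intro v hv
    cases Relation.ReflTransGen.cases_tail hv with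
    | inl h => rw [h]; exact pT 0 (by omega)
    | inr h => obtain ⟨_, _, _, h⟩ := h; exact h
  have pR : ∀ k, k ≤ n → p k ∈ R := by
    intro k
    induction k with
    | zero => intro _; exact Relation.ReflTransGen.refl
    | succ k ih => intro hk; exact (ih (by omega)).tail ⟨padj k hk, pT _ hk⟩
  have Rreach : ∀ (A : Set V) (hA : R ⊆ A) (v : V) (hv : v ∈ R),
      (G.induce A).Reachable ⟨p 0, hA (pR 0 (by omega))⟩ ⟨v, hA hv⟩ := by
    intro A hA v hv
    have hv' : Relation.ReflTransGen (fun a b => G.Adj a b ∧ b ∈ T) (p 0) v := hv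
    induction hv' with
    | refl => exact Reachable.refl _
    | tail h1 h2 ih =>
      refine (ih h1).trans (Adj.reachable ?_)
      exact h2.1
  have noy : ∀ x y, x ∈ R → G.Adj x y → y ∉ Set.range u → y ∈ R := by
    intro x y hx hxy hy
    by_contra hyR
    have hyT : y ∉ T := fun h => hyR (Relation.ReflTransGen.tail hx ⟨hxy, h⟩)
    have hy34 : G.Adj y (u 3) ∨ G.Adj y (u 4) := by
      by_contra hc
      exact hyT ⟨hy, not_or.1 hc⟩
    have Roff : ∀ j, u j ∉ R := fun j h => (RT _ h).1 ⟨j, rfl⟩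
    have yoff : ∀ j, u j ≠ y := fun j h => hy ⟨j, h⟩
    rcases hy34 with h3 | h4
    · have hRA : R ⊆ R ∪ {y, u 3, u 0} := Set.subset_union_left
      have mem : ∀ j : Fin 5, u j ∈ R ∪ {y, u 3, u 0} → j = 3 ∨ j = 0 := by
        intro j hj
        simpa [Roff j, yoff j, hinj.eq_iff] using hj
      obtain ⟨n', p', hp', -, -, -, -, k, hk, hk1⟩ := jump (S.shift 3) (R ∪ {y, u 3, u 0})
        (by right; simp) (by right; simp)
        (fun h => absurd (mem _ h) (by decide)) (fun h => absurd (mem _ h) (by decide))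
        (fun h => absurd (mem _ h) (by decide)) (by
          have s1 := Rreach _ hRA x hx
          have s2 : (G.induce (R ∪ {y, u 3, u 0})).Adj ⟨x, hRA hx⟩ ⟨y, by right; simp⟩ := hxy
          have s3 : (G.induce (R ∪ {y, u 3, u 0})).Adj ⟨y, by right; simp⟩
            ⟨u 3, by right; simp⟩ := h3
          have s4 : (G.induce (R ∪ {y, u 3, u 0})).Adj ⟨p 0, hRA (pR 0 (by omega))⟩
            ⟨u 0, by right; simp⟩ := p0
          exact (s3.reachable.symm.trans (s2.reachable.symm.trans s1.symm)).trans s4.reachable)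
      have hk1' : G.Adj (p' k) (u 4) := hk1
      obtain ⟨hkA, hkoff⟩ := hp' k hk
      have hkoff' : ∀ j, p' k ≠ u j := fun j h => hkoff ⟨j - 3, by simp [h]⟩
      rcases hkA with h | h | h | h
      · exact (RT _ h).2.2 hk1'
      · rw [h] at hk1'
        exact absurd (S.uniq hy h3 hk1') (by decide)
      · exact hkoff' _ h
      · exact hkoff' _ h
    · have hRA : R ⊆ R ∪ {y, u 2, u 4} := Set.subset_union_left
      have mem : ∀ j : Fin 5, u j ∈ R ∪ {y, u 2, u 4} → j = 2 ∨ j = 4 := by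
        intro j hj
        simpa [Roff j, yoff j, hinj.eq_iff] using hj
      obtain ⟨n', p', hp', -, -, -, -, k, hk, hk1⟩ := jump (S.shift 2) (R ∪ {y, u 2, u 4})
        (by right; simp) (by right; simp)
        (fun h => absurd (mem _ h) (by decide)) (fun h => absurd (mem _ h) (by decide))
        (fun h => absurd (mem _ h) (by decide)) (by
          have s1 := Rreach _ hRA x hx
          have s0 := Rreach _ hRA (p n) (pR n le_rfl)
          have s2 : (G.induce (R ∪ {y, u 2, u 4})).Adj ⟨x, hRA hx⟩ ⟨y, by right; simp⟩ := hxy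
          have s3 : (G.induce (R ∪ {y, u 2, u 4})).Adj ⟨y, by right; simp⟩
            ⟨u 4, by right; simp⟩ := h4
          have s4 : (G.induce (R ∪ {y, u 2, u 4})).Adj ⟨p n, hRA (pR n le_rfl)⟩
            ⟨u 2, by right; simp⟩ := pn
          exact (s4.reachable.symm.trans (s0.symm.trans s1)).trans
            (s2.reachable.trans s3.reachable))
      have hk1' : G.Adj (p' k) (u 3) := hk1
      obtain ⟨hkA, hkoff⟩ := hp' k hk
      have hkoff' : ∀ j, p' k ≠ u j := fun j h => hkoff ⟨j - 2, by simp [h]⟩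
      rcases hkA with h | h | h | h
      · exact (RT _ h).2.1 hk1'
      · rw [h] at hk1'
        exact absurd (S.uniq hy h4 hk1') (by decide)
      · exact hkoff' _ h
      · exact hkoff' _ h
  have hp0 : ∀ j, p 0 ≠ u j := fun j h => (hp 0 (by omega)).2 ⟨j, h.symm⟩
  have fin := reach_closed (G.induce (({u 0, u (0 + 1), u 2} : Set V)ᶜ))
    {v | v.val ∈ R} _ _
    (c2.preconnected ⟨p 0, by simp [hp0]⟩ ⟨u 3, by simp [hinj.eq_iff]⟩) (pR 0 (by omega)) (by
      rintro ⟨x, hxX⟩ ⟨y, hyX⟩ hx hxy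
      have hxy' : G.Adj x y := hxy
      have hx' : x ∈ R := hx
      refine noy x y hx' hxy' ?_
      rintro ⟨j, rfl⟩
      fin_cases j
      · exact hyX (by simp)
      · exact hyX (by simp)
      · exact hyX (by simp)
      · exact (RT _ hx').2.1 hxy'
      · exact (RT _ hx').2.2 hxy')
  exact (RT _ fin).1 ⟨3, rfl⟩
end
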